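/- arXiv:1706.05218 — 14 statements merged into one kernel-verified Lean document; each statement's English description precedes it below -/
import Mathlib

section
/- For any ε > 0 and ρ > 0, the infimum W = inf { F(γ) : γ : I × J → ℝ, γ i j ≥ 0 for all i, j } defining the unbalanced entropic optimal transport cost is attained: there exists γ* with all entries nonnegative such that F(γ*) = W. -/
open Finset Real

/-- Entropy `H(γ) = -∑_{i,j} γ i j (log γ i j - 1)` (convention `0·log 0 = 0`). -/
noncomputable def entH {I J : Type*} [Fintype I] [Fintype J] (γ : I → J → ℝ) : ℝ :=
  -∑ i, ∑ j, γ i j * (Real.log (γ i j) - 1)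

/-- Kullback–Leibler divergence `KL(h‖p) = ∑_i (h i log(h i / p i) - h i + p i)`. -/
noncomputable def klD {I : Type*} [Fintype I] (h p : I → ℝ) : ℝ :=
  ∑ i, (h i * Real.log (h i / p i) - h i + p i)

/-- Unbalanced entropic optimal transport objective. -/
noncomputable def Fobj {I J : Type*} [Fintype I] [Fintype J]
    (c : I → J → ℝ) (p : I → ℝ) (q : J → ℝ) (ε ρ : ℝ) (γ : I → J → ℝ) : ℝ :=
  (∑ i, ∑ j, c i j * γ i j) - ε * entH γ
    + ρ * klD (fun i => ∑ j, γ i j) p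
    + ρ * klD (fun j => ∑ i, γ i j) q

theorem aux_fenchel (x m : ℝ) (hx : 0 ≤ x) : x * m - Real.exp m ≤ x * Real.log x - x := by
  rcases hx.eq_or_lt with rfl | hx
  · simp [Real.exp_nonneg]
  · have h := Real.add_one_le_exp (m - Real.log x)
    rw [Real.exp_sub, Real.exp_log hx, le_div_iff₀ hx] at h
    nlinarith

theorem aux_kl_nonneg {I : Type*} [Fintype I] (h p : I → ℝ) (hp : ∀ i, 0 < p i)
    (hh : ∀ i, 0 ≤ h i) : 0 ≤ klD h p := by
  unfold klD
  refine Finset.sum_nonneg fun i _ => ?_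
  rcases (hh i).eq_or_lt with h0 | h0
  · rw [← h0]; simp [(hp i).le]
  · have := aux_fenchel (h i) (Real.log (p i)) h0.le
    rw [Real.exp_log (hp i)] at this
    rw [Real.log_div h0.ne' (hp i).ne']
    nlinarith

theorem aux_kl_cont {I X : Type*} [Fintype I] [TopologicalSpace X] (h : X → I → ℝ) (p : I → ℝ)
    (hp : ∀ i, 0 < p i) (hh : ∀ i, Continuous fun x => h x i) :
    Continuous fun x => klD (h x) p := by
  unfold klD
  refine continuous_finsetSum _ fun i _ => ?_
  have h1 : Continuous fun x => p i * ((h x i / p i) * Real.log (h x i / p i)) :=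
    continuous_const.mul (Real.continuous_mul_log.comp ((hh i).div_const (p i)))
  have h2 : ∀ x, p i * ((h x i / p i) * Real.log (h x i / p i))
      = h x i * Real.log (h x i / p i) := fun x => by
    rw [← mul_assoc, mul_div_cancel₀ _ (hp i).ne']
  simp only [h2] at h1
  exact (h1.sub (hh i)).add continuous_const

theorem aux_ent_cont {I J : Type*} [Fintype I] [Fintype J] :
    Continuous fun γ : I → J → ℝ => entH γ := by
  unfold entH
  refine (continuous_finsetSum _ fun i _ => continuous_finsetSum _ fun j _ => ?_).neg
  have h0 : Continuous fun γ : I → J → ℝ => γ i j := by fun_prop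
  have h1 := (Real.continuous_mul_log.comp h0).sub h0
  refine h1.congr fun γ => ?_
  change γ i j * Real.log (γ i j) - γ i j = γ i j * (Real.log (γ i j) - 1)
  ring

theorem aux_lower {I J : Type*} [Fintype I] [Fintype J]
    (c : I → J → ℝ) (p : I → ℝ) (q : J → ℝ) (hp : ∀ i, 0 < p i) (hq : ∀ j, 0 < q j)
    (ε ρ : ℝ) (hε : 0 < ε) (hρ : 0 < ρ) (γ : I → J → ℝ) (hγ : ∀ i j, 0 ≤ γ i j) :
    (∑ i, ∑ j, γ i j) - (∑ i, ∑ j, ε * Real.exp ((1 - c i j) / ε)) ≤ Fobj c p q ε ρ γ := by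
  have k1 := mul_nonneg hρ.le (aux_kl_nonneg (fun i => ∑ j, γ i j) p hp
    fun i => Finset.sum_nonneg fun j _ => hγ i j)
  have k2 := mul_nonneg hρ.le (aux_kl_nonneg (fun j => ∑ i, γ i j) q hq
    fun j => Finset.sum_nonneg fun i _ => hγ i j)
  have k3 : (∑ i, ∑ j, γ i j) - (∑ i, ∑ j, ε * Real.exp ((1 - c i j) / ε))
      ≤ (∑ i, ∑ j, c i j * γ i j) - ε * entH γ := by
    unfold entH
    rw [mul_neg, sub_neg_eq_add]
    simp only [Finset.mul_sum]
    simp only [← Finset.sum_sub_distrib, ← Finset.sum_add_distrib]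
    refine Finset.sum_le_sum fun i _ => Finset.sum_le_sum fun j _ => ?_
    have h := mul_le_mul_of_nonneg_left (aux_fenchel (γ i j) ((1 - c i j) / ε) (hγ i j)) hε.le
    have e : ε * (γ i j * ((1 - c i j) / ε)) = γ i j * (1 - c i j) := by
      field_simp
    rw [mul_sub, e] at h
    linarith
  unfold Fobj
  linarith

/-- The infimum defining the unbalanced entropic OT cost is attained. -/
theorem stmt_0 {I J : Type*} [Fintype I] [Fintype J] [Nonempty I] [Nonempty J]
    (c : I → J → ℝ) (p : I → ℝ) (q : J → ℝ) (hp : ∀ i, 0 < p i) (hq : ∀ j, 0 < q j)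
    (ε ρ : ℝ) (hε : 0 < ε) (hρ : 0 < ρ) :
    ∃ γstar : I → J → ℝ, (∀ i j, 0 ≤ γstar i j) ∧
      Fobj c p q ε ρ γstar =
        sInf {w : ℝ | ∃ γ : I → J → ℝ, (∀ i j, 0 ≤ γ i j) ∧ Fobj c p q ε ρ γ = w} := by
  classical
  have hcont : Continuous fun γ : I → J → ℝ => Fobj c p q ε ρ γ := by
    unfold Fobj
    refine ((Continuous.sub (by fun_prop) (continuous_const.mul aux_ent_cont)).add
      (continuous_const.mul (aux_kl_cont (fun (γ : I → J → ℝ) i => ∑ j, γ i j) p hp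
        (fun i => by fun_prop)))).add
      (continuous_const.mul (aux_kl_cont (fun (γ : I → J → ℝ) j => ∑ i, γ i j) q hq
        (fun j => by fun_prop)))
  have hlow := aux_lower c p q hp hq ε ρ hε hρ
  set K := ∑ i, ∑ j, ε * Real.exp ((1 - c i j) / ε) with hK
  set R := Fobj c p q ε ρ (fun _ _ => 0) + K with hR
  have hR0 : 0 ≤ R := by
    have := hlow (fun _ _ => 0) (fun _ _ => le_rfl)
    simp only [Finset.sum_const_zero] at this
    linarith
  have hcomp : IsCompact (Set.Icc (fun _ _ => 0 : I → J → ℝ) (fun _ _ => R)) := by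
    have h : IsCompact (Set.pi Set.univ fun _ : I => Set.pi Set.univ fun _ : J =>
        Set.Icc (0 : ℝ) R) :=
      isCompact_univ_pi fun _ => isCompact_univ_pi fun _ => isCompact_Icc
    simpa only [Set.pi_univ_Icc] using h
  have h0mem : (fun _ _ => 0 : I → J → ℝ) ∈
      Set.Icc (fun _ _ => 0 : I → J → ℝ) (fun _ _ => R) :=
    ⟨le_rfl, fun _ _ => hR0⟩
  obtain ⟨g, hg, hmin⟩ := hcomp.exists_isMinOn ⟨_, h0mem⟩ hcont.continuousOn
  refine ⟨g, fun i j => hg.1 i j, ?_⟩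
  have hleast : IsLeast {w : ℝ | ∃ γ : I → J → ℝ, (∀ i j, 0 ≤ γ i j) ∧ Fobj c p q ε ρ γ = w}
      (Fobj c p q ε ρ g) := by
    refine ⟨⟨g, fun i j => hg.1 i j, rfl⟩, ?_⟩
    rintro w ⟨γ, hγ, rfl⟩
    by_cases hm : ∀ i j, γ i j ≤ R
    · exact hmin ⟨fun i j => hγ i j, fun i j => hm i j⟩
    · push Not at hm
      obtain ⟨i, j, hij⟩ := hm
      have h1 := hlow γ hγ
      have h2 : γ i j ≤ ∑ j, γ i j :=
        Finset.single_le_sum (f := fun j => γ i j) (fun j _ => hγ i j) (Finset.mem_univ j)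
      have h3 : ∑ j, γ i j ≤ ∑ i, ∑ j, γ i j :=
        Finset.single_le_sum (f := fun i => ∑ j, γ i j)
          (fun i _ => Finset.sum_nonneg fun j _ => hγ i j) (Finset.mem_univ i)
      have h4 : Fobj c p q ε ρ g ≤ Fobj c p q ε ρ (fun _ _ => 0) := hmin h0mem
      linarith
  exact hleast.csInf_eq.symm
end

section
/- For any ε > 0 and ρ > 0, the objective F is strictly convex on the set { γ : I × J → ℝ : γ i j ≥ 0 for all i, j }; consequently F has at most one minimizer over this set. -/
open Finset Real

theorem mul_log_aux {x y a b : ℝ} (hx : 0 ≤ x) (hy : 0 ≤ y) (ha : 0 < a) (hb : 0 < b)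
    (hab : a + b = 1) :
    (a * x + b * y) * Real.log (a * x + b * y)
      ≤ a * (x * Real.log x) + b * (y * Real.log y) := by
  have h := Real.convexOn_mul_log.2 (Set.mem_Ici.2 hx) (Set.mem_Ici.2 hy) ha.le hb.le hab
  simpa only [smul_eq_mul] using h

theorem mul_log_aux_lt {x y a b : ℝ} (hx : 0 ≤ x) (hy : 0 ≤ y) (hxy : x ≠ y) (ha : 0 < a)
    (hb : 0 < b) (hab : a + b = 1) :
    (a * x + b * y) * Real.log (a * x + b * y)
      < a * (x * Real.log x) + b * (y * Real.log y) := by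
  have h := Real.strictConvexOn_mul_log.2 (Set.mem_Ici.2 hx) (Set.mem_Ici.2 hy) hxy ha hb hab
  simpa only [smul_eq_mul] using h

theorem mul_log_div_aux {x p : ℝ} (hp : 0 < p) :
    x * Real.log (x / p) = x * Real.log x - x * Real.log p := by
  by_cases hx : x = 0
  · simp [hx]
  · rw [Real.log_div hx hp.ne']; ring

theorem klD_aux {I : Type*} [Fintype I] {p x y : I → ℝ} {a b : ℝ} (hp : ∀ i, 0 < p i)
    (hx : ∀ i, 0 ≤ x i) (hy : ∀ i, 0 ≤ y i) (ha : 0 < a) (hb : 0 < b) (hab : a + b = 1) :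
    klD (fun i => a * x i + b * y i) p ≤ a * klD x p + b * klD y p := by
  unfold klD
  rw [Finset.mul_sum, Finset.mul_sum, ← Finset.sum_add_distrib]
  refine Finset.sum_le_sum fun i _ => ?_
  rw [mul_log_div_aux (hp i), mul_log_div_aux (hp i), mul_log_div_aux (hp i)]
  have h := mul_log_aux (hx i) (hy i) ha hb hab
  have h2 : p i = a * p i + b * p i := by rw [← add_mul, hab, one_mul]
  linarith

theorem entH_aux {I J : Type*} [Fintype I] [Fintype J] {x y : I → J → ℝ} {a b : ℝ}
    (hx : ∀ i j, 0 ≤ x i j) (hy : ∀ i j, 0 ≤ y i j) (hxy : x ≠ y)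
    (ha : 0 < a) (hb : 0 < b) (hab : a + b = 1) :
    a * entH x + b * entH y < entH (fun i j => a * x i j + b * y i j) := by
  have hle : ∀ i j, (a * x i j + b * y i j) * (Real.log (a * x i j + b * y i j) - 1)
      ≤ a * (x i j * (Real.log (x i j) - 1)) + b * (y i j * (Real.log (y i j) - 1)) := by
    intro i j
    have h := mul_log_aux (hx i j) (hy i j) ha hb hab
    linarith
  obtain ⟨i, hi⟩ := Function.ne_iff.1 hxy
  obtain ⟨j, hj⟩ := Function.ne_iff.1 hi
  have hlt : (a * x i j + b * y i j) * (Real.log (a * x i j + b * y i j) - 1)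
      < a * (x i j * (Real.log (x i j) - 1)) + b * (y i j * (Real.log (y i j) - 1)) := by
    have h := mul_log_aux_lt (hx i j) (hy i j) hj ha hb hab
    linarith
  have key := Finset.sum_lt_sum (fun i (_ : i ∈ Finset.univ) =>
    Finset.sum_le_sum (fun j (_ : j ∈ Finset.univ) => hle i j))
    ⟨i, Finset.mem_univ i, Finset.sum_lt_sum (fun j _ => hle i j) ⟨j, Finset.mem_univ j, hlt⟩⟩
  simp only [Finset.sum_add_distrib, ← Finset.mul_sum] at key
  unfold entH
  linarith

/-- `F` is strictly convex on the nonnegative orthant; consequently it has at most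
one minimizer there. -/
theorem stmt_1 {I J : Type*} [Fintype I] [Fintype J] [Nonempty I] [Nonempty J]
    (c : I → J → ℝ) (p : I → ℝ) (q : J → ℝ) (hp : ∀ i, 0 < p i) (hq : ∀ j, 0 < q j)
    (ε ρ : ℝ) (hε : 0 < ε) (hρ : 0 < ρ) :
    StrictConvexOn ℝ {γ : I → J → ℝ | ∀ i j, 0 ≤ γ i j} (Fobj c p q ε ρ) ∧
      ∀ γ₁ γ₂ : I → J → ℝ, (∀ i j, 0 ≤ γ₁ i j) → (∀ i j, 0 ≤ γ₂ i j) →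
        (∀ γ : I → J → ℝ, (∀ i j, 0 ≤ γ i j) → Fobj c p q ε ρ γ₁ ≤ Fobj c p q ε ρ γ) →
        (∀ γ : I → J → ℝ, (∀ i j, 0 ≤ γ i j) → Fobj c p q ε ρ γ₂ ≤ Fobj c p q ε ρ γ) →
        γ₁ = γ₂ := by
  have hF : StrictConvexOn ℝ {γ : I → J → ℝ | ∀ i j, 0 ≤ γ i j} (Fobj c p q ε ρ) := by
    refine ⟨?_, ?_⟩
    · intro x hx y hy a b ha hb _ i j
      exact add_nonneg (mul_nonneg ha (hx i j)) (mul_nonneg hb (hy i j))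
    · intro x hx y hy hxy a b ha hb hab
      have h1 := entH_aux hx hy hxy ha hb hab
      have h2 := klD_aux (x := fun i => ∑ j, x i j) (y := fun i => ∑ j, y i j) hp
        (fun i => Finset.sum_nonneg fun j _ => hx i j)
        (fun i => Finset.sum_nonneg fun j _ => hy i j) ha hb hab
      have h3 := klD_aux (x := fun j => ∑ i, x i j) (y := fun j => ∑ i, y i j) hq
        (fun j => Finset.sum_nonneg fun i _ => hx i j)
        (fun j => Finset.sum_nonneg fun i _ => hy i j) ha hb hab
      have e : a • x + b • y = fun i j => a * x i j + b * y i j := rfl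
      have e0 : ∑ i, ∑ j, c i j * (a * x i j + b * y i j)
          = a * (∑ i, ∑ j, c i j * x i j) + b * (∑ i, ∑ j, c i j * y i j) := by
        simp only [Finset.mul_sum, ← Finset.sum_add_distrib]
        exact Finset.sum_congr rfl fun i _ => Finset.sum_congr rfl fun j _ => by ring
      rw [e]
      unfold Fobj
      simp only [smul_eq_mul, e0, Finset.sum_add_distrib, ← Finset.mul_sum]
      have g1 := mul_lt_mul_of_pos_left h1 hε
      have g2 := mul_le_mul_of_nonneg_left h2 hρ.le
      have g3 := mul_le_mul_of_nonneg_left h3 hρ.le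
      linarith
  refine ⟨hF, fun γ₁ γ₂ h₁ h₂ m₁ m₂ => ?_⟩
  exact hF.eq_of_isMinOn (fun γ hγ => m₁ γ hγ) (fun γ hγ => m₂ γ hγ) h₁ h₂
end

section
/- For any ε > 0 and ρ > 0, every minimizer γ* of F over the nonnegative orthant { γ : γ i j ≥ 0 } has all entries strictly positive: γ* i j > 0 for all i ∈ I, j ∈ J. -/
open Finset Real

lemma aux_sum {K : Type*} [Fintype K] [DecidableEq K] (f g : K → ℝ) (k : K) (d : ℝ)
    (h : ∀ x, g x = f x + if x = k then d else 0) : ∑ x, g x = ∑ x, f x + d := by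
  simp [h, Finset.sum_add_distrib]

lemma aux_kl (a t p : ℝ) (ha : 0 ≤ a) (ht : 0 < t) (ht1 : t ≤ 1) (hp : 0 < p) :
    ((a + t) * Real.log ((a + t) / p) - (a + t) + p) - (a * Real.log (a / p) - a + p)
      ≤ t * Real.log ((a + 1) / p) := by
  have h1 : Real.log ((a + t) / p) ≤ Real.log ((a + 1) / p) := by
    apply Real.log_le_log (by positivity)
    gcongr
  have h1' := mul_le_mul_of_nonneg_left h1 ht.le
  have h2 : a * Real.log ((a + t) / p) - a * Real.log (a / p) ≤ t := by
    rcases ha.eq_or_lt with rfl | ha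
    · simpa using ht.le
    · rw [Real.log_div (by positivity) hp.ne', Real.log_div ha.ne' hp.ne']
      have h3 := Real.log_le_sub_one_of_pos (show 0 < (a + t) / a by positivity)
      rw [Real.log_div (by positivity) ha.ne'] at h3
      have h4 := mul_le_mul_of_nonneg_left h3 ha.le
      have h5 : a * ((a + t) / a - 1) = t := by field_simp; ring
      linarith
  linarith

lemma aux_klD {K : Type*} [Fintype K] [DecidableEq K] (h g p : K → ℝ) (k : K) (t : ℝ)
    (hp : ∀ x, 0 < p x) (hh : ∀ x, 0 ≤ h x) (ht : 0 < t) (ht1 : t ≤ 1)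
    (hg : ∀ x, g x = h x + if x = k then t else 0) :
    klD g p ≤ klD h p + t * Real.log ((h k + 1) / p k) := by
  unfold klD
  rw [aux_sum (fun i => h i * Real.log (h i / p i) - h i + p i)
    (fun i => g i * Real.log (g i / p i) - g i + p i) k
    (((h k + t) * Real.log ((h k + t) / p k) - (h k + t) + p k)
      - (h k * Real.log (h k / p k) - h k + p k))]
  · have := aux_kl (h k) t (p k) (hh k) ht ht1 (hp k)
    linarith
  · intro x
    by_cases hx : x = k
    · subst hx; simp [hg]; ring
    · simp [hg, hx]

lemma aux_sum2 {I J : Type*} [Fintype I] [Fintype J] [DecidableEq I] [DecidableEq J]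
    (f g : I → J → ℝ) (i : I) (j : J) (d : ℝ)
    (h : ∀ x y, g x y = f x y + if x = i then (if y = j then d else 0) else 0) :
    ∑ x, ∑ y, g x y = ∑ x, ∑ y, f x y + d := by
  apply aux_sum _ _ i
  intro x
  by_cases hx : x = i
  · simp only [hx, if_true]
    apply aux_sum _ _ j
    intro y
    simp [h]
  · simp [h, hx]

/-- Every minimizer of `F` over the nonnegative orthant has strictly positive entries. -/
theorem stmt_2 {I J : Type*} [Fintype I] [Fintype J] [Nonempty I] [Nonempty J]
    (c : I → J → ℝ) (p : I → ℝ) (q : J → ℝ) (hp : ∀ i, 0 < p i) (hq : ∀ j, 0 < q j)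
    (ε ρ : ℝ) (hε : 0 < ε) (hρ : 0 < ρ)
    (γstar : I → J → ℝ) (hnn : ∀ i j, 0 ≤ γstar i j)
    (hmin : ∀ γ : I → J → ℝ, (∀ i j, 0 ≤ γ i j) →
      Fobj c p q ε ρ γstar ≤ Fobj c p q ε ρ γ) :
    ∀ i j, 0 < γstar i j := by
  classical
  intro i j
  by_contra hneg
  have h0 : γstar i j = 0 := le_antisymm (not_lt.mp hneg) (hnn i j)
  set A := Real.log (((∑ y, γstar i y) + 1) / p i) with hA
  set B := Real.log (((∑ x, γstar x j) + 1) / q j) with hB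
  set K := c i j - ε + ρ * A + ρ * B with hK
  obtain ⟨t, ht, ht1, hlog⟩ : ∃ t : ℝ, 0 < t ∧ t ≤ 1 ∧ ε * Real.log t = -|K| - ε := by
    refine ⟨Real.exp (-(|K| / ε + 1)), Real.exp_pos _, ?_, ?_⟩
    · rw [Real.exp_le_one_iff]
      have : 0 ≤ |K| / ε := by positivity
      linarith
    · rw [Real.log_exp]
      field_simp
      ring
  set γ : I → J → ℝ := fun x y => γstar x y + if x = i then (if y = j then t else 0) else 0 with hγ
  have hm := hmin γ (by
    intro x y
    have := hnn x y
    simp only [hγ]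
    split_ifs <;> linarith)
  have e1 : ∑ x, ∑ y, c x y * γ x y = ∑ x, ∑ y, c x y * γstar x y + c i j * t := by
    apply aux_sum2 _ _ i j
    intro x y
    simp only [hγ]
    split_ifs with h1 h2
    · subst h1; subst h2; ring
    · ring
    · ring
  have e2 : entH γ = entH γstar - t * (Real.log t - 1) := by
    unfold entH
    rw [aux_sum2 (fun x y => γstar x y * (Real.log (γstar x y) - 1))
      (fun x y => γ x y * (Real.log (γ x y) - 1)) i j (t * (Real.log t - 1))]
    · ring
    · intro x y
      simp only [hγ]
      split_ifs with h1 h2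
      · subst h1; subst h2; simp [h0]
      · simp
      · simp
  have e3 := aux_klD (fun x => ∑ y, γstar x y) (fun x => ∑ y, γ x y) p i t hp
    (fun x => Finset.sum_nonneg fun y _ => hnn x y) ht ht1 (by
      intro x
      by_cases hx : x = i <;> simp [hγ, hx, Finset.sum_add_distrib])
  have e4 := aux_klD (fun y => ∑ x, γstar x y) (fun y => ∑ x, γ x y) q j t hq
    (fun y => Finset.sum_nonneg fun x _ => hnn x y) ht ht1 (by
      intro y
      by_cases hy : y = j <;> simp [hγ, hy, Finset.sum_add_distrib])
  simp only [← hA, ← hB] at e3 e4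
  unfold Fobj at hm
  rw [e1, e2] at hm
  have e3' := mul_le_mul_of_nonneg_left e3 hρ.le
  have e4' := mul_le_mul_of_nonneg_left e4 hρ.le
  have h5 : 0 ≤ t * (K + ε * Real.log t) := by
    rw [hK]
    linarith
  have h6 : K + ε * Real.log t < 0 := by
    have := le_abs_self K
    linarith
  have h7 := mul_neg_of_pos_of_neg ht h6
  linarith
end

section
/- Let ε > 0, ρ > 0 and let γ : I × J → ℝ have all entries strictly positive. Then γ minimizes F over the nonnegative orthant if and only if for all i ∈ I, j ∈ J: ε·log(γ i j) + c i j + ρ·log((Σ_{j'} γ i j')/p i) + ρ·log((Σ_{i'} γ i' j)/q j) = 0. -/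
open Finset Real

theorem kl_tangent (x y p : ℝ) (hx : 0 ≤ x) (hy : 0 < y) (hp : 0 < p) :
    (x - y) * Real.log (y / p) ≤
      (x * Real.log (x / p) - x + p) - (y * Real.log (y / p) - y + p) := by
  rcases hx.eq_or_lt with h | h
  · subst h
    simp only [zero_mul, zero_sub]
    nlinarith
  · have h1 := Real.log_le_sub_one_of_pos (div_pos hy h)
    rw [Real.log_div hy.ne' h.ne'] at h1
    rw [Real.log_div hy.ne' hp.ne', Real.log_div h.ne' hp.ne']
    have h2 := mul_le_mul_of_nonneg_left h1 h.le
    have h3 : x * (y / x - 1) = y - x := by field_simp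
    rw [h3] at h2
    nlinarith

theorem kl_deriv (y d p : ℝ) (hy : 0 < y) (hp : 0 < p) :
    HasDerivAt (fun t : ℝ => (y + t * d) * Real.log ((y + t * d) / p) - (y + t * d) + p)
      (d * Real.log (y / p)) 0 := by
  have h0 : HasDerivAt (fun t : ℝ => y + t * d) d 0 := by
    simpa using ((hasDerivAt_id (0 : ℝ)).mul_const d).const_add y
  have h1 := (h0.div_const p).log (by simp only [zero_mul, add_zero]; positivity)
  have h2 := ((h0.mul h1).sub h0).add_const p
  refine h2.congr_deriv ?_
  simp only [zero_mul, add_zero]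
  field_simp
  ring

/-- The gradient of the objective. -/
noncomputable def gradF {I J : Type*} [Fintype I] [Fintype J]
    (c : I → J → ℝ) (p : I → ℝ) (q : J → ℝ) (ε ρ : ℝ) (γ : I → J → ℝ) (i : I) (j : J) : ℝ :=
  ε * Real.log (γ i j) + c i j
          + ρ * Real.log ((∑ j', γ i j') / p i)
          + ρ * Real.log ((∑ i', γ i' j) / q j)

theorem Fobj_eq {I J : Type*} [Fintype I] [Fintype J]
    (c : I → J → ℝ) (p : I → ℝ) (q : J → ℝ) (ε ρ : ℝ) (γ : I → J → ℝ) :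
    Fobj c p q ε ρ γ = (∑ i, ∑ j, (c i j * γ i j
        + ε * (γ i j * Real.log (γ i j / 1) - γ i j + 1 - 1)))
      + ρ * ∑ i, ((∑ j, γ i j) * Real.log ((∑ j, γ i j) / p i) - (∑ j, γ i j) + p i)
      + ρ * ∑ j, ((∑ i, γ i j) * Real.log ((∑ i, γ i j) / q j) - (∑ i, γ i j) + q j) := by
  unfold Fobj entH klD
  simp only [Finset.sum_add_distrib, ← Finset.mul_sum, div_one, add_sub_cancel_right, mul_sub_one]
  ring

theorem grad_sum {I J : Type*} [Fintype I] [Fintype J]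
    (c : I → J → ℝ) (p : I → ℝ) (q : J → ℝ) (ε ρ : ℝ) (γ d : I → J → ℝ) :
    ∑ i, ∑ j, d i j * gradF c p q ε ρ γ i j =
      (∑ i, ∑ j, (c i j * d i j + ε * (d i j * Real.log (γ i j / 1))))
      + ρ * ∑ i, ((∑ j, d i j) * Real.log ((∑ j, γ i j) / p i))
      + ρ * ∑ j, ((∑ i, d i j) * Real.log ((∑ i, γ i j) / q j)) := by
  simp only [Finset.sum_mul]
  rw [Finset.sum_comm (f := fun (j : J) (i : I) => d i j * Real.log ((∑ i, γ i j) / q j))]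
  simp only [Finset.mul_sum, ← Finset.sum_add_distrib]
  refine Finset.sum_congr rfl fun i _ => Finset.sum_congr rfl fun j _ => ?_
  simp only [gradF, div_one]
  ring

theorem Fobj_deriv {I J : Type*} [Fintype I] [Fintype J] [Nonempty I] [Nonempty J]
    (c : I → J → ℝ) (p : I → ℝ) (q : J → ℝ) (hp : ∀ i, 0 < p i) (hq : ∀ j, 0 < q j)
    (ε ρ : ℝ) (γ d : I → J → ℝ) (hpos : ∀ i j, 0 < γ i j) :
    HasDerivAt (fun t : ℝ => Fobj c p q ε ρ (fun i j => γ i j + t * d i j))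
      (∑ i, ∑ j, d i j * gradF c p q ε ρ γ i j) 0 := by
  rw [grad_sum]
  simp only [Fobj_eq, Finset.sum_add_distrib (f := fun j => γ _ j),
    Finset.sum_add_distrib (f := fun i => γ i _), ← Finset.mul_sum]
  refine ((HasDerivAt.fun_sum fun i _ => HasDerivAt.fun_sum fun j _ => ?_).add
    ((HasDerivAt.fun_sum fun i _ => ?_).const_mul ρ)).add
    ((HasDerivAt.fun_sum fun j _ => ?_).const_mul ρ)
  · have h0 : HasDerivAt (fun t : ℝ => γ i j + t * d i j) (d i j) 0 := by
      simpa using ((hasDerivAt_id (0 : ℝ)).mul_const (d i j)).const_add (γ i j)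
    exact (h0.const_mul (c i j)).add
      (((kl_deriv (γ i j) (d i j) 1 (hpos i j) one_pos).sub_const 1).const_mul ε)
  · exact kl_deriv _ _ _ (Finset.sum_pos (fun j _ => hpos i j) Finset.univ_nonempty) (hp i)
  · exact kl_deriv _ _ _ (Finset.sum_pos (fun i _ => hpos i j) Finset.univ_nonempty) (hq j)

theorem Fobj_tangent {I J : Type*} [Fintype I] [Fintype J] [Nonempty I] [Nonempty J]
    (c : I → J → ℝ) (p : I → ℝ) (q : J → ℝ) (hp : ∀ i, 0 < p i) (hq : ∀ j, 0 < q j)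
    (ε ρ : ℝ) (hε : 0 < ε) (hρ : 0 < ρ) (γ γ' : I → J → ℝ) (hpos : ∀ i j, 0 < γ i j)
    (hγ' : ∀ i j, 0 ≤ γ' i j) :
    ∑ i, ∑ j, (γ' i j - γ i j) * gradF c p q ε ρ γ i j ≤
      Fobj c p q ε ρ γ' - Fobj c p q ε ρ γ := by
  rw [grad_sum c p q ε ρ γ (fun i j => γ' i j - γ i j), Fobj_eq, Fobj_eq,
    add_sub_add_comm, add_sub_add_comm, ← mul_sub, ← mul_sub]
  simp only [← Finset.sum_sub_distrib]
  simp only [Finset.sum_sub_distrib (f := fun j => γ' _ j),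
    Finset.sum_sub_distrib (f := fun i => γ' i _)]
  refine add_le_add (add_le_add (Finset.sum_le_sum fun i _ => Finset.sum_le_sum fun j _ => ?_)
    (mul_le_mul_of_nonneg_left (Finset.sum_le_sum fun i _ => ?_) hρ.le))
    (mul_le_mul_of_nonneg_left (Finset.sum_le_sum fun j _ => ?_) hρ.le)
  · have := mul_le_mul_of_nonneg_left
      (kl_tangent (γ' i j) (γ i j) 1 (hγ' i j) (hpos i j) one_pos) hε.le
    linarith
  · exact kl_tangent _ _ _ (Finset.sum_nonneg fun j _ => hγ' i j)
      (Finset.sum_pos (fun j _ => hpos i j) Finset.univ_nonempty) (hp i)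
  · exact kl_tangent _ _ _ (Finset.sum_nonneg fun i _ => hγ' i j)
      (Finset.sum_pos (fun i _ => hpos i j) Finset.univ_nonempty) (hq j)

/-- First-order characterization: a strictly positive `γ` minimizes `F` over the
nonnegative orthant iff the stationarity equations hold. -/
theorem stmt_4 {I J : Type*} [Fintype I] [Fintype J] [Nonempty I] [Nonempty J]
    (c : I → J → ℝ) (p : I → ℝ) (q : J → ℝ) (hp : ∀ i, 0 < p i) (hq : ∀ j, 0 < q j)
    (ε ρ : ℝ) (hε : 0 < ε) (hρ : 0 < ρ)
    (γ : I → J → ℝ) (hpos : ∀ i j, 0 < γ i j) :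
    (∀ γ' : I → J → ℝ, (∀ i j, 0 ≤ γ' i j) →
        Fobj c p q ε ρ γ ≤ Fobj c p q ε ρ γ') ↔
      (∀ i j, ε * Real.log (γ i j) + c i j
          + ρ * Real.log ((∑ j', γ i j') / p i)
          + ρ * Real.log ((∑ i', γ i' j) / q j) = 0) := by
  change _ ↔ ∀ i j, gradF c p q ε ρ γ i j = 0
  constructor
  · intro hmin
    have hd := Fobj_deriv c p q hp hq ε ρ γ (gradF c p q ε ρ γ) hpos
    have hloc : IsLocalMin (fun t : ℝ => Fobj c p q ε ρ
        (fun i j => γ i j + t * gradF c p q ε ρ γ i j)) 0 := by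
      have hev : ∀ᶠ t : ℝ in nhds 0, ∀ i j, 0 < γ i j + t * gradF c p q ε ρ γ i j := by
        rw [Filter.eventually_all]
        intro i
        rw [Filter.eventually_all]
        intro j
        have hc : Continuous (fun t : ℝ => γ i j + t * gradF c p q ε ρ γ i j) := by fun_prop
        exact hc.continuousAt.eventually (lt_mem_nhds (by simpa using hpos i j))
      filter_upwards [hev] with t ht
      simpa using hmin _ (fun i j => (ht i j).le)
    have h0 := hloc.hasDerivAt_eq_zero hd
    intro i j
    rw [Finset.sum_eq_zero_iff_of_nonneg
      (fun i _ => Finset.sum_nonneg fun j _ => mul_self_nonneg _)] at h0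
    have h1 := h0 i (Finset.mem_univ i)
    rw [Finset.sum_eq_zero_iff_of_nonneg (fun j _ => mul_self_nonneg _)] at h1
    exact mul_self_eq_zero.mp (h1 j (Finset.mem_univ j))
  · intro hG γ' hγ'
    have h := Fobj_tangent c p q hp hq ε ρ hε hρ γ γ' hpos hγ'
    simp only [hG, mul_zero, Finset.sum_const_zero] at h
    linarith
end

section
/- Let ε > 0, ρ > 0, λ = ρ/(ρ+ε), and let u : I → ℝ, v : J → ℝ be arbitrary. If u' is the Sinkhorn u-update, u' i = λ·u i + ε·λ·log(p i) − ε·λ·log Σ_j exp(K(u,v) i j), then for every i ∈ I one has the stationarity identity Σ_j exp(K(u',v) i j) = p i · exp(−u' i/ρ). Symmetrically, the Sinkhorn v-update v' satisfies Σ_i exp(K(u',v') i j) = q j · exp(−v' j/ρ) for every j ∈ J. -/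
open Finset Real

/-- The Sinkhorn kernel `K(u,v) i j = (u i + v j - c i j)/ε`. -/
noncomputable def sinkK {I J : Type*} (c : I → J → ℝ) (ε : ℝ)
    (u : I → ℝ) (v : J → ℝ) (i : I) (j : J) : ℝ :=
  (u i + v j - c i j) / ε

/-- After the Sinkhorn `u`-update the `p`-stationarity identity holds for every `i`;
after the subsequent `v`-update the `q`-stationarity identity holds for every `j`. -/
theorem stmt_5 {I J : Type*} [Fintype I] [Fintype J] [Nonempty I] [Nonempty J]
    (c : I → J → ℝ) (p : I → ℝ) (q : J → ℝ) (hp : ∀ i, 0 < p i) (hq : ∀ j, 0 < q j)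
    (ε ρ : ℝ) (hε : 0 < ε) (hρ : 0 < ρ)
    (u : I → ℝ) (v : J → ℝ)
    (lam : ℝ) (hlam : lam = ρ / (ρ + ε))
    (u' : I → ℝ)
    (hu' : ∀ i, u' i = lam * u i + ε * lam * Real.log (p i)
        - ε * lam * Real.log (∑ j, Real.exp (sinkK c ε u v i j)))
    (v' : J → ℝ)
    (hv' : ∀ j, v' j = lam * v j + ε * lam * Real.log (q j)
        - ε * lam * Real.log (∑ i, Real.exp (sinkK c ε u' v i j))) :
    (∀ i, ∑ j, Real.exp (sinkK c ε u' v i j) = p i * Real.exp (-(u' i) / ρ)) ∧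
    (∀ j, ∑ i, Real.exp (sinkK c ε u' v' i j) = q j * Real.exp (-(v' j) / ρ)) := by
  have key : ∀ x x' P S : ℝ, 0 < P → 0 < S →
      x' = lam * x + ε * lam * Real.log P - ε * lam * Real.log S →
      Real.exp ((x' - x) / ε) * S = P * Real.exp (-x' / ρ) := by
    intro x x' P S hP hS h
    have hne : ρ + ε ≠ 0 := by positivity
    have h1 : (x' - x) / ε + Real.log S = Real.log P + -x' / ρ := by
      rw [hlam] at h
      field_simp at h ⊢
      linarith
    calc Real.exp ((x' - x) / ε) * S = Real.exp ((x' - x) / ε + Real.log S) := by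
          rw [Real.exp_add, Real.exp_log hS]
      _ = P * Real.exp (-x' / ρ) := by
          rw [h1, Real.exp_add, Real.exp_log hP]
  constructor
  · intro i
    rw [← key (u i) (u' i) (p i) _ (hp i)
      (Finset.sum_pos (fun j _ => Real.exp_pos _) Finset.univ_nonempty) (hu' i), Finset.mul_sum]
    refine Finset.sum_congr rfl fun j _ => ?_
    rw [← Real.exp_add]
    congr 1
    unfold sinkK
    ring
  · intro j
    rw [← key (v j) (v' j) (q j) _ (hq j)
      (Finset.sum_pos (fun i _ => Real.exp_pos _) Finset.univ_nonempty) (hv' j), Finset.mul_sum]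
    refine Finset.sum_congr rfl fun i _ => ?_
    rw [← Real.exp_add]
    congr 1
    unfold sinkK
    ring
end

section
/- Let ε > 0, ρ > 0, λ = ρ/(ρ+ε). If (u, v) is a fixed point of the Sinkhorn iteration (i.e. applying the u-update to (u,v) returns u, and then applying the v-update returns v), then γ defined by γ i j = exp((u i + v j − c i j)/ε) is the unique minimizer of F over the nonnegative orthant. -/
open Finset Real

theorem dD_pos {x y : ℝ} (hx : 0 ≤ x) (hy : 0 < y) (hne : x ≠ y) :
    0 < x * Real.log x - x * Real.log y - x + y := by
  rcases hx.eq_or_lt with h | h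
  · subst h
    simpa using hy
  · have h1 : Real.log (y / x) < y / x - 1 := by
      apply Real.log_lt_sub_one_of_pos (by positivity)
      intro h2
      rw [div_eq_one_iff_eq h.ne'] at h2
      exact hne h2.symm
    rw [Real.log_div hy.ne' h.ne'] at h1
    have h2 := mul_lt_mul_of_pos_left h1 h
    have h3 : x * (y / x - 1) = y - x := by field_simp
    rw [h3] at h2
    linarith

theorem dD_nonneg {x y : ℝ} (hx : 0 ≤ x) (hy : 0 < y) :
    0 ≤ x * Real.log x - x * Real.log y - x + y := by
  by_cases h : x = y
  · subst h
    simp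
  · exact (dD_pos hx hy h).le

theorem kl_term {x p a r w : ℝ} (hp : 0 < p)
    (hw : w = r * (Real.log p - Real.log a)) :
    w * x + r * (x * Real.log (x / p) - x + p) =
      r * (x * Real.log x - x * Real.log a - x + a) + r * (p - a) := by
  by_cases h : x = 0
  · subst h
    simp
    ring
  · rw [Real.log_div h hp.ne', hw]
    ring

theorem fix_solve {ε ρ lam w P A : ℝ} (hε : 0 < ε) (hρ : 0 < ρ) (hlam : lam = ρ / (ρ + ε))
    (h : w = lam * w + ε * lam * P - ε * lam * A) : w = ρ * (P - A) := by
  have hne : ρ + ε ≠ 0 := by positivity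
  have hl : lam * (ρ + ε) = ρ := by rw [hlam]; field_simp
  have h2 : ε * (w - ρ * (P - A)) = 0 := by
    linear_combination (ρ + ε) * h + (w + ε * P - ε * A) * hl
  rcases mul_eq_zero.mp h2 with h3 | h3
  · exact absurd h3 hε.ne'
  · linarith

theorem Fobj_expand {I J : Type*} [Fintype I] [Fintype J]
    (c : I → J → ℝ) (p : I → ℝ) (q : J → ℝ) (hp : ∀ i, 0 < p i) (hq : ∀ j, 0 < q j)
    (ε ρ : ℝ) (u : I → ℝ) (v : J → ℝ) (a : I → ℝ) (b : J → ℝ) (γ : I → J → ℝ)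
    (hu : ∀ i, u i = ρ * (Real.log (p i) - Real.log (a i)))
    (hv : ∀ j, v j = ρ * (Real.log (q j) - Real.log (b j)))
    (hc : ∀ i j, c i j = u i + v j - ε * Real.log (γ i j)) (g : I → J → ℝ) :
    Fobj c p q ε ρ g =
      ε * (∑ i, ∑ j, (g i j * Real.log (g i j) - g i j * Real.log (γ i j) - g i j + γ i j))
      + ρ * (∑ i, ((∑ j, g i j) * Real.log (∑ j, g i j) - (∑ j, g i j) * Real.log (a i)
          - (∑ j, g i j) + a i))
      + ρ * (∑ j, ((∑ i, g i j) * Real.log (∑ i, g i j) - (∑ i, g i j) * Real.log (b j)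
          - (∑ i, g i j) + b j))
      + (-ε * (∑ i, ∑ j, γ i j) + ∑ i, ρ * (p i - a i) + ∑ j, ρ * (q j - b j)) := by
  have h1 : ∑ i, ∑ j, c i j * g i j + ε * ∑ i, ∑ j, g i j * (Real.log (g i j) - 1) =
      ε * (∑ i, ∑ j, (g i j * Real.log (g i j) - g i j * Real.log (γ i j) - g i j + γ i j))
      + -ε * (∑ i, ∑ j, γ i j) + ∑ i, u i * ∑ j, g i j + ∑ j, v j * ∑ i, g i j := by
    have h2 : ∑ j, v j * ∑ i, g i j = ∑ i, ∑ j, v j * g i j := by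
      rw [Finset.sum_comm]
      simp only [Finset.mul_sum]
    rw [h2]
    simp only [Finset.mul_sum, ← Finset.sum_add_distrib]
    refine Finset.sum_congr rfl fun i _ => Finset.sum_congr rfl fun j _ => ?_
    rw [hc]
    ring
  have h3 := Finset.sum_congr (rfl : (Finset.univ : Finset I) = Finset.univ)
    fun i _ => kl_term (x := ∑ j, g i j) (hp i) (hu i)
  have h4 := Finset.sum_congr (rfl : (Finset.univ : Finset J) = Finset.univ)
    fun j _ => kl_term (x := ∑ i, g i j) (hq j) (hv j)
  rw [Finset.sum_add_distrib, Finset.sum_add_distrib, ← Finset.mul_sum, ← Finset.mul_sum] at h3 h4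
  unfold Fobj entH klD
  linarith

/-- If `(u,v)` is a fixed point of the Sinkhorn iteration, then
`γ i j = exp((u i + v j - c i j)/ε)` is the unique minimizer of `F` over the
nonnegative orthant. -/
theorem stmt_6 {I J : Type*} [Fintype I] [Fintype J] [Nonempty I] [Nonempty J]
    (c : I → J → ℝ) (p : I → ℝ) (q : J → ℝ) (hp : ∀ i, 0 < p i) (hq : ∀ j, 0 < q j)
    (ε ρ : ℝ) (hε : 0 < ε) (hρ : 0 < ρ)
    (lam : ℝ) (hlam : lam = ρ / (ρ + ε))
    (u : I → ℝ) (v : J → ℝ)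
    (hufix : ∀ i, u i = lam * u i + ε * lam * Real.log (p i)
        - ε * lam * Real.log (∑ j, Real.exp (sinkK c ε u v i j)))
    (hvfix : ∀ j, v j = lam * v j + ε * lam * Real.log (q j)
        - ε * lam * Real.log (∑ i, Real.exp (sinkK c ε u v i j)))
    (γ : I → J → ℝ) (hγ : ∀ i j, γ i j = Real.exp (sinkK c ε u v i j)) :
    (∀ γ' : I → J → ℝ, (∀ i j, 0 ≤ γ' i j) →
        Fobj c p q ε ρ γ ≤ Fobj c p q ε ρ γ') ∧
    (∀ γ' : I → J → ℝ, (∀ i j, 0 ≤ γ' i j) →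
        (∀ γ'' : I → J → ℝ, (∀ i j, 0 ≤ γ'' i j) →
          Fobj c p q ε ρ γ' ≤ Fobj c p q ε ρ γ'') → γ' = γ) := by
  have hγpos : ∀ i j, 0 < γ i j := fun i j => by rw [hγ]; exact Real.exp_pos _
  have hc : ∀ i j, c i j = u i + v j - ε * Real.log (γ i j) := fun i j => by
    rw [hγ, Real.log_exp, sinkK]
    field_simp
    ring
  have hu : ∀ i, u i = ρ * (Real.log (p i) - Real.log (∑ j, γ i j)) := fun i => by
    simp only [hγ]
    exact fix_solve hε hρ hlam (hufix i)
  have hv : ∀ j, v j = ρ * (Real.log (q j) - Real.log (∑ i, γ i j)) := fun j => by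
    simp only [hγ]
    exact fix_solve hε hρ hlam (hvfix j)
  have hE := Fobj_expand c p q hp hq ε ρ u v _ _ γ hu hv hc
  have ha : ∀ i, 0 < ∑ j, γ i j := fun i =>
    Finset.sum_pos (fun j _ => hγpos i j) Finset.univ_nonempty
  have hb : ∀ j, 0 < ∑ i, γ i j := fun j =>
    Finset.sum_pos (fun i _ => hγpos i j) Finset.univ_nonempty
  have hE0 := hE γ
  simp only [sub_self, zero_sub, neg_add_cancel, Finset.sum_const_zero, mul_zero,
    zero_add] at hE0
  have key : ∀ g : I → J → ℝ, (∀ i j, 0 ≤ g i j) → Fobj c p q ε ρ γ +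
      ε * (∑ i, ∑ j, (g i j * Real.log (g i j) - g i j * Real.log (γ i j) - g i j + γ i j))
        ≤ Fobj c p q ε ρ g := by
    intro g hg
    rw [hE g, hE0]
    have h1 := mul_nonneg hρ.le (Finset.sum_nonneg fun i (_ : i ∈ Finset.univ) =>
      dD_nonneg (Finset.sum_nonneg fun j (_ : j ∈ Finset.univ) => hg i j) (ha i))
    have h2 := mul_nonneg hρ.le (Finset.sum_nonneg fun j (_ : j ∈ Finset.univ) =>
      dD_nonneg (Finset.sum_nonneg fun i (_ : i ∈ Finset.univ) => hg i j) (hb j))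
    linarith
  constructor
  · intro g hg
    have h1 := key g hg
    have h2 := mul_nonneg hε.le (Finset.sum_nonneg fun i (_ : i ∈ Finset.univ) =>
      Finset.sum_nonneg fun j (_ : j ∈ Finset.univ) => dD_nonneg (hg i j) (hγpos i j))
    linarith
  · intro g hg hmin
    by_contra hne
    have hex : ∃ i j, g i j ≠ γ i j := by
      by_contra hcon
      push Not at hcon
      exact hne (funext fun i => funext fun j => hcon i j)
    obtain ⟨i, j, hij⟩ := hex
    have h1 := key g hg
    have h2 := hmin γ fun i j => (hγpos i j).le
    have h3 : 0 < ∑ i, ∑ j,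
        (g i j * Real.log (g i j) - g i j * Real.log (γ i j) - g i j + γ i j) :=
      Finset.sum_pos' (fun i _ => Finset.sum_nonneg fun j _ => dD_nonneg (hg i j) (hγpos i j))
        ⟨i, Finset.mem_univ i, Finset.sum_pos' (fun j _ => dD_nonneg (hg i j) (hγpos i j))
          ⟨j, Finset.mem_univ j, dD_pos (hg i j) (hγpos i j) hij⟩⟩
    have h4 := mul_pos hε h3
    linarith
end

section
/- Let ε > 0, ρ > 0 and λ = ρ/(ρ+ε) < 1. Define T : (J → ℝ) → (J → ℝ) as one full Sinkhorn sweep on the v-variable: given v, first u' i = ε·λ·log(p i) − ε·λ·log Σ_j exp((v j − c i j)/ε), then (T v) j = ε·λ·log(q j) − ε·λ·log Σ_i exp((u' i − c i j)/ε). Then T is λ²-Lipschitz for the supremum norm; consequently T has a unique fixed point v* and for any initial v₀ the iterates satisfy max_j |(Tⁿ v₀) j − v* j| ≤ λ^{2n} · max_j |v₀ j − v* j|, i.e. the Sinkhorn iterations converge linearly. -/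
open Finset Real

theorem lse_one {K : Type*} [Fintype K] [Nonempty K] (a b c : K → ℝ) (ε D : ℝ) (hε : 0 < ε)
    (h : ∀ k, a k ≤ b k + D) :
    ε * Real.log (∑ k, Real.exp ((a k - c k) / ε))
      ≤ ε * Real.log (∑ k, Real.exp ((b k - c k) / ε)) + D := by
  have pos : ∀ f : K → ℝ, 0 < ∑ k, Real.exp (f k) := fun f =>
    Finset.sum_pos (fun k _ => Real.exp_pos _) Finset.univ_nonempty
  have h1 : ∑ k, Real.exp ((a k - c k) / ε)
      ≤ Real.exp (D / ε) * ∑ k, Real.exp ((b k - c k) / ε) := by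
    rw [Finset.mul_sum]
    refine Finset.sum_le_sum fun k _ => ?_
    rw [← Real.exp_add, ← add_div]
    apply Real.exp_le_exp.2
    have := h k
    gcongr
    linarith
  have h2 := Real.log_le_log (pos _) h1
  rw [Real.log_mul (Real.exp_pos _).ne' (pos _).ne', Real.log_exp] at h2
  have h3 := mul_le_mul_of_nonneg_left h2 hε.le
  have h4 : ε * (D / ε) = D := by field_simp
  rw [mul_add, h4] at h3
  linarith

theorem lse_abs {K : Type*} [Fintype K] [Nonempty K] (a b c : K → ℝ) (ε lam D r : ℝ)
    (hε : 0 < ε) (hl : 0 ≤ lam) (h : ∀ k, |a k - b k| ≤ D) :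
    |(ε * lam * r - ε * lam * Real.log (∑ k, Real.exp ((a k - c k) / ε)))
      - (ε * lam * r - ε * lam * Real.log (∑ k, Real.exp ((b k - c k) / ε)))| ≤ lam * D := by
  have h1 := mul_le_mul_of_nonneg_left
    (lse_one a b c ε D hε fun k => by linarith [(abs_le.1 (h k)).2]) hl
  have h2 := mul_le_mul_of_nonneg_left
    (lse_one b a c ε D hε fun k => by linarith [(abs_le.1 (h k)).1]) hl
  rw [abs_le]
  constructor <;> nlinarith

theorem sup_eq_dist {J : Type*} [Fintype J] [Nonempty J] (v w : J → ℝ) :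
    Finset.univ.sup' Finset.univ_nonempty (fun j => |v j - w j|) = dist v w := by
  apply le_antisymm
  · refine Finset.sup'_le _ _ fun j _ => ?_
    rw [← Real.dist_eq]
    exact dist_le_pi_dist v w j
  · refine (dist_pi_le_iff').2 fun j => ?_
    rw [Real.dist_eq]
    exact Finset.le_sup' (fun j => |v j - w j|) (Finset.mem_univ j)

/-- One full Sinkhorn sweep on the `v`-variable is a `λ²`-contraction for the sup
norm; hence it has a unique fixed point and the iterates converge linearly to it. -/
theorem stmt_8 {I J : Type*} [Fintype I] [Fintype J] [Nonempty I] [Nonempty J]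
    (c : I → J → ℝ) (p : I → ℝ) (q : J → ℝ) (hp : ∀ i, 0 < p i) (hq : ∀ j, 0 < q j)
    (ε ρ : ℝ) (hε : 0 < ε) (hρ : 0 < ρ)
    (lam : ℝ) (hlam : lam = ρ / (ρ + ε))
    (T : (J → ℝ) → (J → ℝ))
    (hT : ∀ v : J → ℝ, ∀ j : J,
      T v j = ε * lam * Real.log (q j)
        - ε * lam * Real.log (∑ i, Real.exp
            (((fun i => ε * lam * Real.log (p i)
                - ε * lam * Real.log (∑ j', Real.exp ((v j' - c i j') / ε))) i
              - c i j) / ε))) :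
    (∀ v₁ v₂ : J → ℝ,
        Finset.univ.sup' Finset.univ_nonempty (fun j => |T v₁ j - T v₂ j|)
          ≤ lam ^ 2 * Finset.univ.sup' Finset.univ_nonempty (fun j => |v₁ j - v₂ j|)) ∧
    (∃! vstar : J → ℝ, T vstar = vstar) ∧
    (∀ vstar : J → ℝ, T vstar = vstar →
      ∀ v₀ : J → ℝ, ∀ n : ℕ,
        Finset.univ.sup' Finset.univ_nonempty (fun j => |(T^[n] v₀) j - vstar j|)
          ≤ lam ^ (2 * n) *
            Finset.univ.sup' Finset.univ_nonempty (fun j => |v₀ j - vstar j|)) := by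
  have hl0 : 0 < lam := by rw [hlam]; positivity
  have hl1 : lam < 1 := by rw [hlam, div_lt_one (by positivity)]; linarith
  have key : ∀ v w : J → ℝ, dist (T v) (T w) ≤ lam ^ 2 * dist v w := by
    intro v w
    refine (dist_pi_le_iff').2 fun j => ?_
    rw [Real.dist_eq, hT, hT, pow_two, mul_assoc lam lam]
    refine lse_abs _ _ (fun i => c i j) ε lam _ _ hε hl0.le fun i => ?_
    refine lse_abs v w (c i) ε lam _ _ hε hl0.le fun j' => ?_
    rw [← Real.dist_eq]
    exact dist_le_pi_dist v w j'
  simp only [sup_eq_dist]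
  have hc : ContractingWith ⟨lam ^ 2, by positivity⟩ T := by
    refine ⟨?_, LipschitzWith.of_dist_le_mul key⟩
    apply NNReal.coe_lt_coe.1
    exact pow_lt_one₀ hl0.le hl1 two_ne_zero
  refine ⟨key, ⟨_, hc.fixedPoint_isFixedPt, fun y hy => hc.fixedPoint_unique hy⟩, ?_⟩
  intro vs hvs v₀ n
  induction n with
  | zero => simp
  | succ n ih =>
    rw [Function.iterate_succ_apply']
    calc dist (T (T^[n] v₀)) vs = dist (T (T^[n] v₀)) (T vs) := by rw [hvs]
      _ ≤ lam ^ 2 * dist (T^[n] v₀) vs := key _ _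
      _ ≤ lam ^ 2 * (lam ^ (2 * n) * dist v₀ vs) := by gcongr
      _ = lam ^ (2 * (n + 1)) * dist v₀ vs := by ring
end

section
/- Weak duality: for all γ : I × J → ℝ with γ i j ≥ 0 and all u : I → ℝ, v : J → ℝ, one has F(γ) ≥ D(u,v), where D(u,v) = −ε·Σ_{i,j} exp((u i + v j − c i j)/ε) − ρ·Σ_i p i·(exp(−u i/ρ) − 1) − ρ·Σ_j q j·(exp(−v j/ρ) − 1). -/
open Finset Real

/-- Dual functional of unbalanced entropic optimal transport. -/
noncomputable def Dobj {I J : Type*} [Fintype I] [Fintype J]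
    (c : I → J → ℝ) (p : I → ℝ) (q : J → ℝ) (ε ρ : ℝ) (u : I → ℝ) (v : J → ℝ) : ℝ :=
  -ε * (∑ i, ∑ j, Real.exp ((u i + v j - c i j) / ε))
    - ρ * (∑ i, p i * (Real.exp (-(u i) / ρ) - 1))
    - ρ * (∑ j, q j * (Real.exp (-(v j) / ρ) - 1))

theorem fenchel_aux (x s : ℝ) (hx : 0 ≤ x) :
    x * s - Real.exp s ≤ x * (Real.log x - 1) := by
  rcases hx.eq_or_lt with rfl | hx
  · have := Real.exp_pos s
    simp only [zero_mul]; linarith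
  · have h := Real.add_one_le_exp (s - Real.log x)
    rw [Real.exp_sub, Real.exp_log hx, le_div_iff₀ hx] at h
    nlinarith

theorem kl_aux {K : Type*} [Fintype K] (h r w : K → ℝ) (ρ : ℝ) (hρ : 0 < ρ)
    (hr : ∀ i, 0 < r i) (hh : ∀ i, 0 ≤ h i) :
    -(∑ i, h i * w i) - ρ * (∑ i, r i * (Real.exp (-(w i) / ρ) - 1)) ≤ ρ * klD h r := by
  unfold klD
  rw [Finset.mul_sum, Finset.mul_sum, ← Finset.sum_neg_distrib, ← Finset.sum_sub_distrib]
  refine Finset.sum_le_sum fun i _ => ?_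
  have hi := hr i
  have h1 := fenchel_aux (h i / r i) (-(w i) / ρ) (div_nonneg (hh i) hi.le)
  have h2 := mul_le_mul_of_nonneg_left h1 (mul_pos hρ hi).le
  have e1 : ρ * r i * (h i / r i * (-(w i) / ρ) - Real.exp (-(w i) / ρ))
      = -(h i * w i) - ρ * r i * Real.exp (-(w i) / ρ) := by
    field_simp
  have e2 : ρ * r i * (h i / r i * (Real.log (h i / r i) - 1))
      = ρ * (h i * Real.log (h i / r i) - h i) := by
    generalize Real.log (h i / r i) = L
    field_simp
  rw [e1, e2] at h2
  linarith

theorem ent_aux {I J : Type*} [Fintype I] [Fintype J] (c γ : I → J → ℝ) (ε : ℝ) (hε : 0 < ε)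
    (hnn : ∀ i j, 0 ≤ γ i j) (u : I → ℝ) (v : J → ℝ) :
    (∑ i, ∑ j, γ i j * u i) + (∑ i, ∑ j, γ i j * v j)
      - ε * (∑ i, ∑ j, Real.exp ((u i + v j - c i j) / ε))
      ≤ (∑ i, ∑ j, c i j * γ i j) - ε * entH γ := by
  unfold entH
  rw [mul_neg, sub_neg_eq_add]
  simp only [Finset.mul_sum, ← Finset.sum_add_distrib, ← Finset.sum_sub_distrib]
  refine Finset.sum_le_sum fun i _ => Finset.sum_le_sum fun j _ => ?_
  have h1 := fenchel_aux (γ i j) ((u i + v j - c i j) / ε) (hnn i j)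
  have h2 := mul_le_mul_of_nonneg_left h1 hε.le
  have e1 : ε * (γ i j * ((u i + v j - c i j) / ε) - Real.exp ((u i + v j - c i j) / ε))
      = γ i j * (u i + v j - c i j) - ε * Real.exp ((u i + v j - c i j) / ε) := by
    generalize Real.exp ((u i + v j - c i j) / ε) = L
    field_simp
  rw [e1] at h2
  linarith

/-- Weak duality: `F(γ) ≥ D(u,v)` for every nonnegative `γ` and every `(u,v)`. -/
theorem stmt_9 {I J : Type*} [Fintype I] [Fintype J] [Nonempty I] [Nonempty J]
    (c : I → J → ℝ) (p : I → ℝ) (q : J → ℝ) (hp : ∀ i, 0 < p i) (hq : ∀ j, 0 < q j)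
    (ε ρ : ℝ) (hε : 0 < ε) (hρ : 0 < ρ)
    (γ : I → J → ℝ) (hnn : ∀ i j, 0 ≤ γ i j) (u : I → ℝ) (v : J → ℝ) :
    Dobj c p q ε ρ u v ≤ Fobj c p q ε ρ γ := by
  have h1 := ent_aux c γ ε hε hnn u v
  have h2 := kl_aux (fun i => ∑ j, γ i j) p u ρ hρ hp (fun i => Finset.sum_nonneg fun j _ => hnn i j)
  have h3 := kl_aux (fun j => ∑ i, γ i j) q v ρ hρ hq (fun j => Finset.sum_nonneg fun i _ => hnn i j)
  simp only [Finset.sum_mul] at h2 h3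
  rw [Finset.sum_comm (f := fun j i => γ i j * v j)] at h3
  unfold Dobj Fobj
  linarith
end

section
/- Let ε > 0, ρ > 0 and suppose u : I → ℝ, v : J → ℝ satisfy the stationarity relations Σ_j exp((u i + v j − c i j)/ε) = p i·exp(−u i/ρ) for all i and Σ_i exp((u i + v j − c i j)/ε) = q j·exp(−v j/ρ) for all j. Then for γ given by γ i j = exp((u i + v j − c i j)/ε) one has the exact value identity F(γ) = D(u,v) = −ε·Σ_{i,j} γ i j − ρ·Σ_i p i·(exp(−u i/ρ) − 1) − ρ·Σ_j q j·(exp(−v j/ρ) − 1). -/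
open Finset Real

/-- Value of the KL term at a stationary marginal. -/
theorem klD_stationary {K : Type*} [Fintype K] (h p u : K → ℝ) (ρ : ℝ) (hρ : 0 < ρ)
    (hp : ∀ i, 0 < p i) (hh : ∀ i, h i = p i * Real.exp (-(u i) / ρ)) :
    ρ * klD h p = -(∑ i, u i * h i) - ρ * ∑ i, p i * (Real.exp (-(u i) / ρ) - 1) := by
  unfold klD
  rw [Finset.mul_sum, Finset.mul_sum, ← Finset.sum_neg_distrib, ← Finset.sum_sub_distrib]
  refine Finset.sum_congr rfl fun i _ => ?_
  have h1 : h i / p i = Real.exp (-(u i) / ρ) := by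
    rw [hh i, mul_div_cancel_left₀ _ (hp i).ne']
  rw [h1, Real.log_exp]
  have h2 : ρ * (-(u i) / ρ) = -(u i) := by field_simp
  linear_combination (h i) * h2 - ρ * hh i

/-- Under the stationarity relations, the primal and dual values coincide exactly. -/
theorem stmt_10 {I J : Type*} [Fintype I] [Fintype J] [Nonempty I] [Nonempty J]
    (c : I → J → ℝ) (p : I → ℝ) (q : J → ℝ) (hp : ∀ i, 0 < p i) (hq : ∀ j, 0 < q j)
    (ε ρ : ℝ) (hε : 0 < ε) (hρ : 0 < ρ)
    (u : I → ℝ) (v : J → ℝ)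
    (hstatp : ∀ i, ∑ j, Real.exp ((u i + v j - c i j) / ε)
        = p i * Real.exp (-(u i) / ρ))
    (hstatq : ∀ j, ∑ i, Real.exp ((u i + v j - c i j) / ε)
        = q j * Real.exp (-(v j) / ρ))
    (γ : I → J → ℝ) (hγ : ∀ i j, γ i j = Real.exp ((u i + v j - c i j) / ε)) :
    Fobj c p q ε ρ γ = Dobj c p q ε ρ u v ∧
    Fobj c p q ε ρ γ
      = -ε * (∑ i, ∑ j, γ i j)
        - ρ * (∑ i, p i * (Real.exp (-(u i) / ρ) - 1))
        - ρ * (∑ j, q j * (Real.exp (-(v j) / ρ) - 1)) := by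
  have key : Fobj c p q ε ρ γ
      = -ε * (∑ i, ∑ j, γ i j)
        - ρ * (∑ i, p i * (Real.exp (-(u i) / ρ) - 1))
        - ρ * (∑ j, q j * (Real.exp (-(v j) / ρ) - 1)) := by
    have h1 := klD_stationary (fun i => ∑ j, γ i j) p u ρ hρ hp
      (fun i => by simp only [hγ]; exact hstatp i)
    have h2 := klD_stationary (fun j => ∑ i, γ i j) q v ρ hρ hq
      (fun j => by simp only [hγ]; exact hstatq j)
    have h3 : (∑ i, ∑ j, c i j * γ i j) - ε * entH γ
        = (∑ i, u i * ∑ j, γ i j) + (∑ j, v j * ∑ i, γ i j) - ε * ∑ i, ∑ j, γ i j := by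
      have h4 : (∑ j, v j * ∑ i, γ i j) = ∑ i, ∑ j, v j * γ i j := by
        simp only [Finset.mul_sum]
        exact Finset.sum_comm
      rw [h4]
      unfold entH
      rw [mul_neg, sub_neg_eq_add]
      simp only [Finset.mul_sum, ← Finset.sum_add_distrib, ← Finset.sum_sub_distrib]
      refine Finset.sum_congr rfl fun i _ => Finset.sum_congr rfl fun j _ => ?_
      have h5 : ε * Real.log (γ i j) = u i + v j - c i j := by
        rw [hγ, Real.log_exp]
        field_simp
      linear_combination (γ i j) * h5
    unfold Fobj
    rw [h1, h2, h3]
    ring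
  refine ⟨?_, key⟩
  rw [key]
  unfold Dobj
  simp only [hγ]
end

section
/- Strong duality: for ε > 0 and ρ > 0, the minimum of F over { γ : γ i j ≥ 0 } equals the supremum of D over all (u, v) ∈ (I → ℝ) × (J → ℝ), and the supremum is attained (at the fixed point of the Sinkhorn iteration). -/
open Finset Real

lemma ws_symm {I J : Type*} [Fintype I] [Fintype J]
    (c : I → J → ℝ) (p : I → ℝ) (q : J → ℝ) (ε ρ : ℝ) (u : I → ℝ) (v : J → ℝ) :
    Dobj (fun j i => c i j) q p ε ρ v u = Dobj c p q ε ρ u v := by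
  unfold Dobj
  rw [Finset.sum_comm]
  simp only [add_comm (v _) (u _)]
  ring

/-- coordinate bounds on superlevel sets -/
lemma ws_bound {I J : Type*} [Fintype I] [Fintype J]
    (c : I → J → ℝ) (p : I → ℝ) (q : J → ℝ) (hp : ∀ i, 0 < p i) (hq : ∀ j, 0 < q j)
    (ε ρ : ℝ) (hε : 0 < ε) (hρ : 0 < ρ) (D0 T : ℝ)
    (hT : T = ρ * (∑ i, p i) + ρ * (∑ j, q j) - D0) (u : I → ℝ) (v : J → ℝ)
    (h : D0 ≤ Dobj c p q ε ρ u v) :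
    (∀ i, -(T / p i) ≤ u i) ∧ (∀ i j, u i + v j - c i j ≤ T) := by
  unfold Dobj at h
  simp only [mul_sub, Finset.sum_sub_distrib, mul_one] at h
  have hA : 0 ≤ ∑ i, ∑ j, Real.exp ((u i + v j - c i j) / ε) := by positivity
  have hB : 0 ≤ ∑ i, p i * Real.exp (-(u i) / ρ) :=
    Finset.sum_nonneg fun i _ => mul_nonneg (hp i).le (Real.exp_pos _).le
  have hC : 0 ≤ ∑ j, q j * Real.exp (-(v j) / ρ) :=
    Finset.sum_nonneg fun i _ => mul_nonneg (hq i).le (Real.exp_pos _).le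
  have hA' := mul_nonneg hε.le hA
  have hB' := mul_nonneg hρ.le hB
  have hC' := mul_nonneg hρ.le hC
  constructor
  · intro i
    have h1 : p i * Real.exp (-(u i) / ρ) ≤ ∑ i, p i * Real.exp (-(u i) / ρ) :=
      Finset.single_le_sum (f := fun i => p i * Real.exp (-(u i) / ρ))
        (fun i _ => mul_nonneg (hp i).le (Real.exp_pos _).le) (Finset.mem_univ i)
    have h2 : -(u i) / ρ ≤ Real.exp (-(u i) / ρ) := by
      linarith [Real.add_one_le_exp (-(u i) / ρ)]
    have h3 : p i * (-(u i) / ρ) ≤ p i * Real.exp (-(u i) / ρ) :=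
      mul_le_mul_of_nonneg_left h2 (hp i).le
    have h4 := mul_le_mul_of_nonneg_left (h3.trans h1) hρ.le
    have h5 : ρ * (p i * (-(u i) / ρ)) = p i * (-u i) := by field_simp
    rw [neg_le, le_div_iff₀ (hp i)]
    linarith
  · intro i j
    have h1 : Real.exp ((u i + v j - c i j) / ε) ≤ ∑ i, ∑ j, Real.exp ((u i + v j - c i j) / ε) :=
      (Finset.single_le_sum (f := fun j => Real.exp ((u i + v j - c i j) / ε))
        (fun i _ => (Real.exp_pos _).le) (Finset.mem_univ j)).trans
      (Finset.single_le_sum (f := fun i => ∑ j, Real.exp ((u i + v j - c i j) / ε))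
        (fun i _ => by positivity) (Finset.mem_univ i))
    have h2 := Real.add_one_le_exp ((u i + v j - c i j) / ε)
    have h4 := mul_le_mul_of_nonneg_left (h2.trans h1) hε.le
    have h5 : ε * ((u i + v j - c i j) / ε + 1) = u i + v j - c i j + ε := by field_simp
    linarith

lemma ws_exists_max {I J : Type*} [Fintype I] [Fintype J] [Nonempty I] [Nonempty J]
    (c : I → J → ℝ) (p : I → ℝ) (q : J → ℝ) (hp : ∀ i, 0 < p i) (hq : ∀ j, 0 < q j)
    (ε ρ : ℝ) (hε : 0 < ε) (hρ : 0 < ρ) :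
    ∃ u v, ∀ u' v', Dobj c p q ε ρ u' v' ≤ Dobj c p q ε ρ u v := by
  let D : (I → ℝ) × (J → ℝ) → ℝ := fun x => Dobj c p q ε ρ x.1 x.2
  have hD : Continuous D := by
    unfold D Dobj
    fun_prop
  obtain ⟨i0⟩ := ‹Nonempty I›
  obtain ⟨j0⟩ := ‹Nonempty J›
  obtain ⟨T, hT⟩ : ∃ T, T = ρ * (∑ i, p i) + ρ * (∑ j, q j) - D 0 := ⟨_, rfl⟩
  let S := {x | D 0 ≤ D x}
  have hSc : IsClosed S := isClosed_le continuous_const hD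
  have hsub : S ⊆ (Set.Icc (fun i => -(T / p i)) (fun i => T + c i j0 + T / q j0)) ×ˢ
      (Set.Icc (fun j => -(T / q j)) (fun j => T + c i0 j + T / p i0)) := by
    rintro ⟨u, v⟩ hx
    obtain ⟨h1, h2⟩ := ws_bound c p q hp hq ε ρ hε hρ _ T hT u v hx
    obtain ⟨h3, -⟩ := ws_bound (fun j i => c i j) q p hq hp ε ρ hε hρ _ T
      (by rw [hT]; ring) v u (hx.trans (ws_symm c p q ε ρ u v).ge)
    refine ⟨⟨h1, fun i => ?_⟩, ⟨h3, fun j => ?_⟩⟩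
    · have := h2 i j0; have := h3 j0; dsimp only; linarith
    · have := h2 i0 j; have := h1 i0; dsimp only; linarith
  have hS : IsCompact S := (isCompact_Icc.prod isCompact_Icc).of_isClosed_subset hSc hsub
  have hne : S.Nonempty := ⟨0, le_refl (D 0)⟩
  obtain ⟨x, hx, hmax⟩ := hS.exists_isMaxOn hne hD.continuousOn
  clear hsub hSc
  refine ⟨x.1, x.2, fun u' v' => ?_⟩
  by_cases h : D 0 ≤ D (u', v')
  · have hm : ((u', v') : (I → ℝ) × (J → ℝ)) ∈ S := h
    exact isMaxOn_iff.mp hmax (u', v') hm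
  · have hx' : D 0 ≤ D x := hx
    have h3 : D (u', v') ≤ D x := (not_le.mp h).le.trans hx'
    exact h3

/-- first-order conditions -/
lemma ws_foc {I J : Type*} [Fintype I] [Fintype J]
    (c : I → J → ℝ) (p : I → ℝ) (q : J → ℝ) (ε ρ : ℝ) (hε : 0 < ε) (hρ : 0 < ρ)
    (u : I → ℝ) (v : J → ℝ) (h : ∀ u', Dobj c p q ε ρ u' v ≤ Dobj c p q ε ρ u v) (i : I) :
    ∑ j, Real.exp ((u i + v j - c i j) / ε) = p i * Real.exp (-(u i) / ρ) := by
  classical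
  let φ : I → ℝ → ℝ := fun i t =>
    -ε * (∑ j, Real.exp ((t + v j - c i j) / ε)) - ρ * (p i * (Real.exp (-t / ρ) - 1))
  have hφ : ∀ w : I → ℝ, Dobj c p q ε ρ w v =
      ∑ i, φ i (w i) - ρ * (∑ j, q j * (Real.exp (-(v j) / ρ) - 1)) := by
    intro w
    simp only [Dobj, φ, Finset.sum_sub_distrib, Finset.mul_sum]
  have hmax : ∀ t, φ i t ≤ φ i (u i) := by
    intro t
    have h1 := h (Function.update u i t)
    rw [hφ, hφ, ← Finset.add_sum_erase _ _ (Finset.mem_univ i),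
      ← Finset.add_sum_erase _ (fun i => φ i (u i)) (Finset.mem_univ i)] at h1
    have h2 : ∑ x ∈ Finset.univ.erase i, φ x (Function.update u i t x)
        = ∑ x ∈ Finset.univ.erase i, φ x (u x) := by
      refine Finset.sum_congr rfl fun x hx => ?_
      rw [Function.update_of_ne (Finset.ne_of_mem_erase hx)]
    rw [h2, Function.update_self] at h1
    linarith
  have hd : HasDerivAt (φ i)
      (-ε * (∑ j, Real.exp ((u i + v j - c i j) / ε) * (1 / ε))
        - ρ * (p i * (Real.exp (-(u i) / ρ) * (-1 / ρ)))) (u i) := by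
    refine HasDerivAt.sub (HasDerivAt.const_mul _ (HasDerivAt.fun_sum fun j _ => ?_))
      (HasDerivAt.const_mul _ (HasDerivAt.const_mul _ (HasDerivAt.sub_const _ ?_)))
    · exact ((((hasDerivAt_id (u i)).add_const _).sub_const _).div_const _).exp
    · exact ((hasDerivAt_id (u i)).neg.div_const _).exp
  have h0 := IsLocalMax.hasDerivAt_eq_zero (Filter.Eventually.of_forall hmax) hd
  rw [← Finset.sum_mul] at h0
  field_simp at h0
  rw [neg_div]
  linarith

/-- Young inequality for the entropy -/
lemma ws_young (x s : ℝ) (hx : 0 ≤ x) : s * x - Real.exp s ≤ x * (Real.log x - 1) := by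
  rcases hx.eq_or_lt with rfl | hx
  · simp [(Real.exp_pos s).le]
  · have h := Real.add_one_le_exp (s - Real.log x)
    rw [Real.exp_sub, Real.exp_log hx, le_div_iff₀ hx] at h
    linarith

lemma ws_kl {I : Type*} [Fintype I] (a p u : I → ℝ) (ρ : ℝ) (hρ : 0 < ρ) (ha : ∀ i, 0 ≤ a i)
    (hp : ∀ i, 0 < p i) :
    -(∑ i, u i * a i) - ρ * (∑ i, p i * (Real.exp (-(u i) / ρ) - 1)) ≤ ρ * klD a p := by
  unfold klD
  rw [Finset.mul_sum, Finset.mul_sum, ← Finset.sum_neg_distrib, ← Finset.sum_sub_distrib]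
  refine Finset.sum_le_sum fun i _ => ?_
  have h := ws_young (a i / p i) (-(u i) / ρ) (div_nonneg (ha i) (hp i).le)
  have h2 := mul_le_mul_of_nonneg_left h (mul_pos hρ (hp i)).le
  have hpi := (hp i).ne'
  have e1 : ρ * p i * (-(u i) / ρ * (a i / p i) - Real.exp (-(u i) / ρ))
      = -(u i * a i) - ρ * (p i * Real.exp (-(u i) / ρ)) := by field_simp
  have e2 : ρ * p i * (a i / p i * (Real.log (a i / p i) - 1))
      = ρ * (a i * Real.log (a i / p i) - a i) := by field_simp
  rw [e1, e2] at h2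
  linarith

lemma ws_weak {I J : Type*} [Fintype I] [Fintype J]
    (c : I → J → ℝ) (p : I → ℝ) (q : J → ℝ) (hp : ∀ i, 0 < p i) (hq : ∀ j, 0 < q j)
    (ε ρ : ℝ) (hε : 0 < ε) (hρ : 0 < ρ) (γ : I → J → ℝ) (hγ : ∀ i j, 0 ≤ γ i j)
    (u : I → ℝ) (v : J → ℝ) : Dobj c p q ε ρ u v ≤ Fobj c p q ε ρ γ := by
  have h1 := ws_kl (fun i => ∑ j, γ i j) p u ρ hρ
    (fun i => Finset.sum_nonneg fun j _ => hγ i j) hp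
  have h2 := ws_kl (fun j => ∑ i, γ i j) q v ρ hρ
    (fun j => Finset.sum_nonneg fun i _ => hγ i j) hq
  have h3 : ∑ i, ∑ j, (u i * γ i j + v j * γ i j - ε * Real.exp ((u i + v j - c i j) / ε)) ≤
      ∑ i, ∑ j, (c i j * γ i j + ε * (γ i j * (Real.log (γ i j) - 1))) := by
    refine Finset.sum_le_sum fun i _ => Finset.sum_le_sum fun j _ => ?_
    have h := mul_le_mul_of_nonneg_left
      (ws_young (γ i j) ((u i + v j - c i j) / ε) (hγ i j)) hε.le
    have e : ε * ((u i + v j - c i j) / ε * γ i j - Real.exp ((u i + v j - c i j) / ε))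
      = (u i + v j - c i j) * γ i j - ε * Real.exp ((u i + v j - c i j) / ε) := by field_simp
    rw [e] at h
    linarith
  have h4 : ∑ j, v j * ∑ i, γ i j = ∑ i, ∑ j, v j * γ i j := by
    rw [Finset.sum_comm]; simp only [Finset.mul_sum]
  rw [h4] at h2
  simp only [Finset.sum_sub_distrib, Finset.sum_add_distrib, ← Finset.mul_sum] at h3
  simp only [Finset.mul_sum] at h3 
  unfold Fobj Dobj entH
  simp only [Finset.mul_sum, ← Finset.sum_neg_distrib] at *
  simp only [neg_mul, mul_neg, Finset.sum_neg_distrib] at *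
  linarith

lemma ws_kl_eq {I : Type*} [Fintype I] (a p u : I → ℝ) (ρ : ℝ) (hρ : 0 < ρ)
    (hp : ∀ i, 0 < p i) (ha : ∀ i, a i = p i * Real.exp (-(u i) / ρ)) :
    ρ * klD a p = -(∑ i, u i * a i) - ρ * (∑ i, p i * (Real.exp (-(u i) / ρ) - 1)) := by
  unfold klD
  rw [Finset.mul_sum, Finset.mul_sum, ← Finset.sum_neg_distrib, ← Finset.sum_sub_distrib]
  refine Finset.sum_congr rfl fun i _ => ?_
  have : a i / p i = Real.exp (-(u i) / ρ) := by
    rw [ha, mul_div_cancel_left₀ _ (hp i).ne']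
  rw [this, Real.log_exp, ha]
  field_simp
  ring

lemma ws_eq {I J : Type*} [Fintype I] [Fintype J]
    (c : I → J → ℝ) (p : I → ℝ) (q : J → ℝ) (hp : ∀ i, 0 < p i) (hq : ∀ j, 0 < q j)
    (ε ρ : ℝ) (hε : 0 < ε) (hρ : 0 < ρ) (u : I → ℝ) (v : J → ℝ)
    (hu : ∀ i, ∑ j, Real.exp ((u i + v j - c i j) / ε) = p i * Real.exp (-(u i) / ρ))
    (hv : ∀ j, ∑ i, Real.exp ((u i + v j - c i j) / ε) = q j * Real.exp (-(v j) / ρ)) :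
    Fobj c p q ε ρ (fun i j => Real.exp ((u i + v j - c i j) / ε)) = Dobj c p q ε ρ u v := by
  unfold Fobj Dobj entH
  rw [ws_kl_eq _ p u ρ hρ hp hu, ws_kl_eq _ q v ρ hρ hq hv]
  have h4 : ∑ j, v j * ∑ i, Real.exp ((u i + v j - c i j) / ε)
      = ∑ i, ∑ j, v j * Real.exp ((u i + v j - c i j) / ε) := by
    rw [Finset.sum_comm]; simp only [Finset.mul_sum]
  rw [h4]
  have h3 : ∑ i, ∑ j, (u i * Real.exp ((u i + v j - c i j) / ε)
        + v j * Real.exp ((u i + v j - c i j) / ε) - ε * Real.exp ((u i + v j - c i j) / ε)) =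
      ∑ i, ∑ j, (c i j * Real.exp ((u i + v j - c i j) / ε) + ε *
        (Real.exp ((u i + v j - c i j) / ε)
          * (Real.log (Real.exp ((u i + v j - c i j) / ε)) - 1))) := by
    refine Finset.sum_congr rfl fun i _ => Finset.sum_congr rfl fun j _ => ?_
    rw [Real.log_exp]
    generalize Real.exp ((u i + v j - c i j) / ε) = E
    field_simp
    ring
  simp only [Finset.sum_sub_distrib, Finset.sum_add_distrib, ← Finset.mul_sum] at h3
  simp only [← Finset.mul_sum]
  linarith

/-- Strong duality: the minimum of `F` over the nonnegative orthant equals the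
supremum of `D`, and both are attained. -/
theorem stmt_11 {I J : Type*} [Fintype I] [Fintype J] [Nonempty I] [Nonempty J]
    (c : I → J → ℝ) (p : I → ℝ) (q : J → ℝ) (hp : ∀ i, 0 < p i) (hq : ∀ j, 0 < q j)
    (ε ρ : ℝ) (hε : 0 < ε) (hρ : 0 < ρ) :
    ∃ m : ℝ,
      IsLeast {w : ℝ | ∃ γ : I → J → ℝ, (∀ i j, 0 ≤ γ i j) ∧ Fobj c p q ε ρ γ = w} m ∧
      IsGreatest {w : ℝ | ∃ u : I → ℝ, ∃ v : J → ℝ, Dobj c p q ε ρ u v = w} m := by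
  obtain ⟨u, v, hmax⟩ := ws_exists_max c p q hp hq ε ρ hε hρ
  have hu := ws_foc c p q ε ρ hε hρ u v (fun u' => hmax u' v)
  have hv := ws_foc (fun j i => c i j) q p ε ρ hε hρ v u
    (fun v' => by rw [ws_symm c p q ε ρ u v', ws_symm c p q ε ρ u v]; exact hmax u v')
  simp only [add_comm (v _) (u _)] at hv
  refine ⟨Dobj c p q ε ρ u v, ⟨⟨_, fun i j => (Real.exp_pos _).le,
    ws_eq c p q hp hq ε ρ hε hρ u v hu hv⟩, ?_⟩, ⟨⟨u, v, rfl⟩, ?_⟩⟩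
  · rintro w ⟨γ, hγ, rfl⟩
    exact ws_weak c p q hp hq ε ρ hε hρ γ hγ u v
  · rintro w ⟨u', v', rfl⟩
    exact hmax u' v'
end

section
/- Let ε > 0, ρ > 0 and fix v : J → ℝ. The function u ↦ D(u,v) on (I → ℝ) is strictly concave, and it attains its unique maximum exactly at the Sinkhorn u-update applied to (u₀, v) for any u₀, namely at u' i = ε·(ρ/(ρ+ε))·log(p i) − ε·(ρ/(ρ+ε))·log Σ_j exp((v j − c i j)/ε). In particular each Sinkhorn half-step does not decrease the dual objective D. -/
open Finset Real

/-- One coordinate of the dual functional. -/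
noncomputable def gcoord (S p ε ρ x : ℝ) : ℝ :=
  -ε * (S * Real.exp (x / ε)) - ρ * (p * (Real.exp (-x / ρ) - 1))

lemma Dobj_eq_gcoord {I J : Type*} [Fintype I] [Fintype J]
    (c : I → J → ℝ) (p : I → ℝ) (q : J → ℝ) (ε ρ : ℝ) (u : I → ℝ) (v : J → ℝ) :
    Dobj c p q ε ρ u v = (∑ i, gcoord (∑ j, Real.exp ((v j - c i j) / ε)) (p i) ε ρ (u i))
      - ρ * (∑ j, q j * (Real.exp (-(v j) / ρ) - 1)) := by
  unfold Dobj gcoord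
  rw [Finset.sum_sub_distrib, ← Finset.mul_sum, ← Finset.mul_sum]
  congr 3
  refine Finset.sum_congr rfl fun i _ => ?_
  rw [Finset.sum_mul]
  refine Finset.sum_congr rfl fun j _ => ?_
  rw [← Real.exp_add]
  congr 1
  ring

lemma gcoord_strict (S p ε ρ : ℝ) (hS : 0 < S) (hp : 0 < p) (hε : 0 < ε) (hρ : 0 < ρ) :
    StrictConcaveOn ℝ Set.univ (gcoord S p ε ρ) := by
  refine ⟨convex_univ, fun x _ y _ hxy a b ha hb hab => ?_⟩
  have h1 := strictConvexOn_exp.2 (Set.mem_univ (x / ε)) (Set.mem_univ (y / ε))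
    (fun h => hxy ((div_left_inj' hε.ne').1 h)) ha hb hab
  have h2 := strictConvexOn_exp.2 (Set.mem_univ (-x / ρ)) (Set.mem_univ (-y / ρ))
    (fun h => hxy (neg_injective ((div_left_inj' hρ.ne').1 h))) ha hb hab
  simp only [smul_eq_mul] at h1 h2 ⊢
  have e1 : a * (x / ε) + b * (y / ε) = (a * x + b * y) / ε := by ring
  have e2 : a * (-x / ρ) + b * (-y / ρ) = -(a * x + b * y) / ρ := by ring
  rw [e1] at h1
  rw [e2] at h2
  have k1 := mul_lt_mul_of_pos_left h1 (mul_pos hε hS)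
  have k2 := mul_lt_mul_of_pos_left h2 (mul_pos hρ hp)
  have hb' : b = 1 - a := by linarith
  unfold gcoord
  have e3 : ρ * p = a * (ρ * p) + b * (ρ * p) := by rw [← add_mul, hab, one_mul]
  linarith

lemma gcoord_max (S p ε ρ : ℝ) (hS : 0 < S) (hp : 0 < p) (hε : 0 < ε) (hρ : 0 < ρ) (w : ℝ)
    (hw : w = ε * (ρ / (ρ + ε)) * Real.log p - ε * (ρ / (ρ + ε)) * Real.log S)
    (x : ℝ) (hx : x ≠ w) : gcoord S p ε ρ x < gcoord S p ε ρ w := by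
  have key : S * Real.exp (w / ε) = p * Real.exp (-w / ρ) := by
    have h : Real.log S + w / ε = Real.log p + -w / ρ := by
      rw [hw]
      field_simp
      ring
    calc S * Real.exp (w / ε) = Real.exp (Real.log S + w / ε) := by
          rw [Real.exp_add, Real.exp_log hS]
      _ = p * Real.exp (-w / ρ) := by rw [h, Real.exp_add, Real.exp_log hp]
  have ht : x - w ≠ 0 := sub_ne_zero.2 hx
  have h1 := Real.add_one_lt_exp (div_ne_zero ht hε.ne')
  have h2 := Real.add_one_lt_exp (div_ne_zero (neg_ne_zero.2 ht) hρ.ne')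
  have k1 := mul_lt_mul_of_pos_left h1 hε
  have k2 := mul_lt_mul_of_pos_left h2 hρ
  have e1 : ε * ((x - w) / ε + 1) = (x - w) + ε := by field_simp
  have e2 : ρ * (-(x - w) / ρ + 1) = -(x - w) + ρ := by field_simp
  rw [e1] at k1
  rw [e2] at k2
  have f1 : Real.exp (x / ε) = Real.exp (w / ε) * Real.exp ((x - w) / ε) := by
    rw [← Real.exp_add]; congr 1; ring
  have f2 : Real.exp (-x / ρ) = Real.exp (-w / ρ) * Real.exp (-(x - w) / ρ) := by
    rw [← Real.exp_add]; congr 1; ring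
  have hK : 0 < S * Real.exp (w / ε) := mul_pos hS (Real.exp_pos _)
  have k3 := mul_lt_mul_of_pos_left (add_lt_add k1 k2) hK
  have g1 : gcoord S p ε ρ x = ρ * p - (S * Real.exp (w / ε)) *
      (ε * Real.exp ((x - w) / ε) + ρ * Real.exp (-(x - w) / ρ)) := by
    unfold gcoord
    rw [f1, f2]
    linear_combination (ρ * Real.exp (-(x - w) / ρ)) * key
  have g2 : gcoord S p ε ρ w = ρ * p - (S * Real.exp (w / ε)) * (ε + ρ) := by
    unfold gcoord
    linear_combination ρ * key
  rw [g1, g2]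
  linarith

/-- For fixed `v`, `u ↦ D(u,v)` is strictly concave and attains its unique maximum
at the Sinkhorn `u`-update; in particular the half-step does not decrease `D`. -/
theorem stmt_12 {I J : Type*} [Fintype I] [Fintype J] [Nonempty I] [Nonempty J]
    (c : I → J → ℝ) (p : I → ℝ) (q : J → ℝ) (hp : ∀ i, 0 < p i) (hq : ∀ j, 0 < q j)
    (ε ρ : ℝ) (hε : 0 < ε) (hρ : 0 < ρ)
    (v : J → ℝ)
    (u' : I → ℝ)
    (hu' : ∀ i, u' i = ε * (ρ / (ρ + ε)) * Real.log (p i)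
        - ε * (ρ / (ρ + ε)) * Real.log (∑ j, Real.exp ((v j - c i j) / ε))) :
    StrictConcaveOn ℝ Set.univ (fun u : I → ℝ => Dobj c p q ε ρ u v) ∧
    (∀ u : I → ℝ, u ≠ u' → Dobj c p q ε ρ u v < Dobj c p q ε ρ u' v) ∧
    (∀ u₀ : I → ℝ, Dobj c p q ε ρ u₀ v ≤ Dobj c p q ε ρ u' v) := by
  have hS : ∀ i, 0 < ∑ j, Real.exp ((v j - c i j) / ε) := fun i =>
    Finset.sum_pos (fun j _ => Real.exp_pos _) Finset.univ_nonempty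
  have hmax : ∀ u : I → ℝ, u ≠ u' → Dobj c p q ε ρ u v < Dobj c p q ε ρ u' v := by
    intro u hu
    rw [Dobj_eq_gcoord, Dobj_eq_gcoord]
    obtain ⟨i, hi⟩ := Function.ne_iff.1 hu
    refine sub_lt_sub_right (Finset.sum_lt_sum (fun k _ => ?_) ⟨i, Finset.mem_univ i, ?_⟩) _
    · by_cases hk : u k = u' k
      · rw [hk]
      · exact (gcoord_max _ _ ε ρ (hS k) (hp k) hε hρ _ (hu' k) _ hk).le
    · exact gcoord_max _ _ ε ρ (hS i) (hp i) hε hρ _ (hu' i) _ hi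
  refine ⟨⟨convex_univ, fun x _ y _ hxy a b ha hb hab => ?_⟩, hmax, fun u => ?_⟩
  · simp only [Dobj_eq_gcoord, smul_eq_mul, Pi.add_apply, Pi.smul_apply]
    obtain ⟨i, hi⟩ := Function.ne_iff.1 hxy
    set C := ρ * (∑ j, q j * (Real.exp (-(v j) / ρ) - 1))
    have hC : C = a * C + b * C := by rw [← add_mul, hab, one_mul]
    have hlt : ∑ k, (a * gcoord (∑ j, Real.exp ((v j - c k j) / ε)) (p k) ε ρ (x k)
          + b * gcoord (∑ j, Real.exp ((v j - c k j) / ε)) (p k) ε ρ (y k))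
        < ∑ k, gcoord (∑ j, Real.exp ((v j - c k j) / ε)) (p k) ε ρ (a * x k + b * y k) := by
      refine Finset.sum_lt_sum (fun k _ => ?_) ⟨i, Finset.mem_univ i, ?_⟩
      · exact (gcoord_strict _ _ ε ρ (hS k) (hp k) hε hρ).concaveOn.2
          (Set.mem_univ _) (Set.mem_univ _) ha.le hb.le hab
      · exact (gcoord_strict _ _ ε ρ (hS i) (hp i) hε hρ).2
          (Set.mem_univ _) (Set.mem_univ _) hi ha hb hab
    rw [Finset.sum_add_distrib, ← Finset.mul_sum, ← Finset.mul_sum] at hlt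
    linarith
  · by_cases h : u = u'
    · rw [h]
    · exact (hmax u h).le
end

section
/- Let ε > 0, ρ > 0, fix c and q, and define W(p) = min { F_p(γ) : γ i j ≥ 0 } where F_p is the unbalanced entropic objective with source weights p. Then W is differentiable on the open positive orthant { p : p i > 0 for all i }, and its gradient at p is given coordinatewise by ∂W/∂p i = ρ·(1 − exp(−u i/ρ)) = ρ·(1 − (Σ_j γ* i j)/p i), where γ* is the unique minimizer of F_p and u i = −ρ·log((Σ_j γ* i j)/p i). -/
open Finset Real

/-- The unbalanced entropic transport cost as a function of the source weights. -/
noncomputable def Wfun {I J : Type*} [Fintype I] [Fintype J]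
    (c : I → J → ℝ) (q : J → ℝ) (ε ρ : ℝ) (p : I → ℝ) : ℝ :=
  sInf {w : ℝ | ∃ γ : I → J → ℝ, (∀ i j, 0 ≤ γ i j) ∧ Fobj c p q ε ρ γ = w}


lemma key_ineq (x s : ℝ) (hx : 0 ≤ x) : s * x - Real.exp s ≤ x * Real.log x - x := by
  rcases hx.eq_or_lt with h | h
  · subst h; simp [Real.exp_nonneg]
  · have h1 := Real.add_one_le_exp (s - Real.log x)
    rw [Real.exp_sub, Real.exp_log h, le_div_iff₀ h] at h1
    nlinarith

/-- scaled version, for KL terms -/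
lemma kl_ineq (a p s : ℝ) (ha : 0 ≤ a) (hp : 0 < p) :
    s * a - p * Real.exp s + p ≤ a * Real.log (a / p) - a + p := by
  have h := key_ineq (a / p) s (by positivity)
  have h2 := mul_le_mul_of_nonneg_left h hp.le
  have e : p * (a / p) = a := by field_simp
  have e1 : p * (s * (a / p) - Real.exp s) = s * (p * (a / p)) - p * Real.exp s := by ring
  have e2 : p * (a / p * Real.log (a / p) - a / p)
      = (p * (a / p)) * Real.log (a / p) - p * (a / p) := by ring
  rw [e1, e2, e] at h2
  linarith

lemma grad_ineq (x y : ℝ) (hx : 0 ≤ x) (h : 0 < y ∨ x = y) :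
    y * (Real.log y - 1) - x * (Real.log x - 1) ≤ (y - x) * Real.log y := by
  rcases h with h | h
  · have := key_ineq x (Real.log y) hx
    rw [Real.exp_log h] at this
    nlinarith
  · subst h; simp

lemma kl_grad_ineq (x y p : ℝ) (hx : 0 ≤ x) (hp : 0 < p) (h : 0 < y ∨ x = y) :
    (y * Real.log (y / p) - y + p) - (x * Real.log (x / p) - x + p)
      ≤ (y - x) * Real.log (y / p) := by
  rcases h with h | h
  · have := kl_ineq x p (Real.log (y / p)) hx hp
    have e : p * (y / p) = y := by field_simp
    rw [Real.exp_log (by positivity), e] at this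
    nlinarith
  · subst h; simp

section
variable {I J : Type*} [Fintype I] [Fintype J]

lemma Fobj_grad (c : I → J → ℝ) (q : J → ℝ) (hq : ∀ j, 0 < q j)
    (ε ρ : ℝ) (hε : 0 < ε) (hρ : 0 < ρ) (p : I → ℝ) (hp : ∀ i, 0 < p i)
    (γ γ' : I → J → ℝ) (hnn : ∀ i j, 0 ≤ γ i j)
    (h1 : ∀ i j, 0 < γ' i j ∨ γ i j = γ' i j)
    (h2 : ∀ i, 0 < ∑ j, γ' i j ∨ ∑ j, γ i j = ∑ j, γ' i j)
    (h3 : ∀ j, 0 < ∑ i, γ' i j ∨ ∑ i, γ i j = ∑ i, γ' i j) :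
    Fobj c p q ε ρ γ' - Fobj c p q ε ρ γ ≤ ∑ i, ∑ j, (γ' i j - γ i j) *
      (c i j + ε * Real.log (γ' i j) + ρ * Real.log ((∑ j, γ' i j) / p i)
        + ρ * Real.log ((∑ i, γ' i j) / q j)) := by
  have A : ∑ i, ∑ j, (γ' i j * (Real.log (γ' i j) - 1) - γ i j * (Real.log (γ i j) - 1))
      ≤ ∑ i, ∑ j, (γ' i j - γ i j) * Real.log (γ' i j) :=
    sum_le_sum fun i _ => sum_le_sum fun j _ => grad_ineq _ _ (hnn i j) (h1 i j)
  have B : klD (fun i => ∑ j, γ' i j) p - klD (fun i => ∑ j, γ i j) p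
      ≤ ∑ i, ∑ j, (γ' i j - γ i j) * Real.log ((∑ j, γ' i j) / p i) := by
    unfold klD
    rw [← sum_sub_distrib]
    refine sum_le_sum fun i _ => ?_
    rw [← sum_mul, sum_sub_distrib]
    exact kl_grad_ineq _ _ _ (sum_nonneg fun j _ => hnn i j) (hp i) (h2 i)
  have C : klD (fun j => ∑ i, γ' i j) q - klD (fun j => ∑ i, γ i j) q
      ≤ ∑ i, ∑ j, (γ' i j - γ i j) * Real.log ((∑ i, γ' i j) / q j) := by
    unfold klD
    rw [← sum_sub_distrib, sum_comm]
    refine sum_le_sum fun j _ => ?_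
    rw [← sum_mul, sum_sub_distrib]
    exact kl_grad_ineq _ _ _ (sum_nonneg fun i _ => hnn i j) (hq j) (h3 j)
  have R : ∑ i, ∑ j, (γ' i j - γ i j) *
      (c i j + ε * Real.log (γ' i j) + ρ * Real.log ((∑ j, γ' i j) / p i)
        + ρ * Real.log ((∑ i, γ' i j) / q j))
      = ((∑ i, ∑ j, c i j * γ' i j) - ∑ i, ∑ j, c i j * γ i j)
        + ε * (∑ i, ∑ j, (γ' i j - γ i j) * Real.log (γ' i j))
        + ρ * (∑ i, ∑ j, (γ' i j - γ i j) * Real.log ((∑ j, γ' i j) / p i))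
        + ρ * (∑ i, ∑ j, (γ' i j - γ i j) * Real.log ((∑ i, γ' i j) / q j)) := by
    simp only [mul_sum, ← sum_add_distrib, ← sum_sub_distrib]
    refine sum_congr rfl fun i _ => sum_congr rfl fun j _ => ?_
    ring
  rw [R]
  have A' := mul_le_mul_of_nonneg_left A hε.le
  have B' := mul_le_mul_of_nonneg_left B hρ.le
  have C' := mul_le_mul_of_nonneg_left C hρ.le
  unfold Fobj entH
  simp only [sum_sub_distrib] at A' B' C' ⊢
  linarith

/-- One-entry perturbation inequality. -/
lemma pert (c : I → J → ℝ) (q : J → ℝ) (hq : ∀ j, 0 < q j)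
    (ε ρ : ℝ) (hε : 0 < ε) (hρ : 0 < ρ) (p : I → ℝ) (hp : ∀ i, 0 < p i)
    (γ : I → J → ℝ) (hnn : ∀ i j, 0 ≤ γ i j)
    (hmin : ∀ γ' : I → J → ℝ, (∀ i j, 0 ≤ γ' i j) →
      Fobj c p q ε ρ γ ≤ Fobj c p q ε ρ γ') (i : I) (j : J) (t : ℝ) (ht : 0 < γ i j + t) :
    0 ≤ t * (c i j + ε * Real.log (γ i j + t) + ρ * Real.log (((∑ j, γ i j) + t) / p i)
        + ρ * Real.log (((∑ i, γ i j) + t) / q j)) := by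
  classical
  set γ' : I → J → ℝ := fun k l => γ k l + if k = i then (if l = j then t else 0) else 0 with hγ'
  have r : ∀ k, ∑ l, γ' k l = (∑ l, γ k l) + if k = i then t else 0 := by
    intro k
    simp only [hγ', sum_add_distrib]
    split_ifs <;> simp
  have s : ∀ l, ∑ k, γ' k l = (∑ k, γ k l) + if l = j then t else 0 := by
    intro l
    simp [hγ', sum_add_distrib]
  have h1 : ∀ k l, 0 < γ' k l ∨ γ k l = γ' k l := by
    intro k l
    by_cases hk : k = i
    · by_cases hl : l = j
      · left; subst hk hl; simpa [hγ'] using ht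
      · right; simp [hγ', hl]
    · right; simp [hγ', hk]
  have nn' : ∀ k l, 0 ≤ γ' k l := by
    intro k l
    rcases h1 k l with h | h
    · exact h.le
    · rw [← h]; exact hnn k l
  have hpos : 0 < γ' i j := by simpa [hγ'] using ht
  have h2 : ∀ k, 0 < ∑ l, γ' k l ∨ ∑ l, γ k l = ∑ l, γ' k l := by
    intro k
    by_cases hk : k = i
    · left; subst hk
      exact sum_pos' (fun l _ => nn' _ l) ⟨j, mem_univ _, hpos⟩
    · right; rw [r]; simp [hk]
  have h3 : ∀ l, 0 < ∑ k, γ' k l ∨ ∑ k, γ k l = ∑ k, γ' k l := by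
    intro k
    by_cases hk : k = j
    · left; subst hk
      exact sum_pos' (fun l _ => nn' l _) ⟨i, mem_univ _, hpos⟩
    · right; rw [s]; simp [hk]
  have G := Fobj_grad c q hq ε ρ hε hρ p hp γ γ' hnn h1 h2 h3
  have M := hmin γ' nn'
  rw [sum_eq_single i, sum_eq_single j] at G
  · rw [r, s] at G
    simp only [hγ', if_true] at G
    have : γ i j + t - γ i j = t := by ring
    rw [this] at G
    linarith
  · intro l _ hl; simp [hγ', hl]
  · simp
  · intro k _ hk; apply sum_eq_zero; intro l _; simp [hγ', hk]
  · simp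

lemma gpos (c : I → J → ℝ) (q : J → ℝ) (hq : ∀ j, 0 < q j)
    (ε ρ : ℝ) (hε : 0 < ε) (hρ : 0 < ρ) (p : I → ℝ) (hp : ∀ i, 0 < p i)
    (γ : I → J → ℝ) (hnn : ∀ i j, 0 ≤ γ i j)
    (hmin : ∀ γ' : I → J → ℝ, (∀ i j, 0 ≤ γ' i j) →
      Fobj c p q ε ρ γ ≤ Fobj c p q ε ρ γ') (i : I) (j : J) : 0 < γ i j := by
  refine (hnn i j).lt_of_ne' fun h0 => ?_
  have P := pert c q hq ε ρ hε hρ p hp γ hnn hmin i j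
  rw [h0] at P
  have ha : 0 ≤ ∑ j, γ i j := sum_nonneg fun j _ => hnn i j
  have hb : 0 ≤ ∑ i, γ i j := sum_nonneg fun i _ => hnn i j
  set a := ∑ j, γ i j
  set b := ∑ i, γ i j
  set K := c i j + ρ * Real.log ((a + 1) / p i) + ρ * Real.log ((b + 1) / q j) with hK
  set t := Real.exp (-(|K| + 1) / ε) with ht
  have t0 : 0 < t := Real.exp_pos _
  have t1 : t ≤ 1 := Real.exp_le_one_iff.2 (div_nonpos_of_nonpos_of_nonneg (by linarith [abs_nonneg K]) hε.le)
  have Q := nonneg_of_mul_nonneg_right (P t (by linarith)) t0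
  have l1 : Real.log ((a + t) / p i) ≤ Real.log ((a + 1) / p i) := by
    have := hp i
    apply Real.log_le_log (by positivity)
    gcongr
  have l2 : Real.log ((b + t) / q j) ≤ Real.log ((b + 1) / q j) := by
    have := hq j
    apply Real.log_le_log (by positivity)
    gcongr
  have l3 : ε * Real.log (0 + t) = -(|K| + 1) := by
    rw [zero_add, ht, Real.log_exp]; field_simp
  have l1' := mul_le_mul_of_nonneg_left l1 hρ.le
  have l2' := mul_le_mul_of_nonneg_left l2 hρ.le
  have := le_abs_self K
  linarith

lemma stat (c : I → J → ℝ) (q : J → ℝ) (hq : ∀ j, 0 < q j)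
    (ε ρ : ℝ) (hε : 0 < ε) (hρ : 0 < ρ) (p : I → ℝ) (hp : ∀ i, 0 < p i)
    (γ : I → J → ℝ) (hnn : ∀ i j, 0 ≤ γ i j)
    (hmin : ∀ γ' : I → J → ℝ, (∀ i j, 0 ≤ γ' i j) →
      Fobj c p q ε ρ γ ≤ Fobj c p q ε ρ γ') (i : I) (j : J) :
    c i j + ε * Real.log (γ i j) + ρ * Real.log ((∑ j, γ i j) / p i)
        + ρ * Real.log ((∑ i, γ i j) / q j) = 0 := by
  have gp := gpos c q hq ε ρ hε hρ p hp γ hnn hmin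
  have P := pert c q hq ε ρ hε hρ p hp γ hnn hmin i j
  have hg := gp i j
  have ha : 0 < ∑ j, γ i j := sum_pos' (fun j _ => hnn i j) ⟨j, mem_univ _, hg⟩
  have hb : 0 < ∑ i, γ i j := sum_pos' (fun i _ => hnn i j) ⟨i, mem_univ _, hg⟩
  set a := ∑ j, γ i j
  set b := ∑ i, γ i j
  set g := γ i j
  have hpi := hp i
  have hqj := hq j
  set G : ℝ → ℝ := fun t => c i j + ε * Real.log (g + t) + ρ * Real.log ((a + t) / p i)
        + ρ * Real.log ((b + t) / q j) with hG
  have hc : ContinuousAt G 0 := by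
    have e1 : g + 0 ≠ 0 := by simpa using hg.ne'
    have e2 : (a + 0) / p i ≠ 0 := by simpa using ⟨ha.ne', hpi.ne'⟩
    have e3 : (b + 0) / q j ≠ 0 := by simpa using ⟨hb.ne', hqj.ne'⟩
    have c1 : ContinuousAt (fun t : ℝ => Real.log (g + t)) 0 :=
      ContinuousAt.log (by fun_prop) e1
    have c2 : ContinuousAt (fun t : ℝ => Real.log ((a + t) / p i)) 0 :=
      ContinuousAt.log (by fun_prop) e2
    have c3 : ContinuousAt (fun t : ℝ => Real.log ((b + t) / q j)) 0 :=
      ContinuousAt.log (by fun_prop) e3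
    exact ((continuousAt_const.add (c1.const_mul ε)).add (c2.const_mul ρ)).add (c3.const_mul ρ)
  have h0 : G 0 = 0 := by
    apply le_antisymm
    · refine le_of_tendsto (hc.tendsto.mono_left (nhdsWithin_le_nhds (s := Set.Iio 0))) ?_
      filter_upwards [self_mem_nhdsWithin, mem_nhdsWithin_of_mem_nhds (Ioi_mem_nhds (show -g < 0 by linarith))] with t ht ht2
      have := P t (by have : -g < t := ht2; linarith)
      exact nonpos_of_mul_nonneg_right this ht
    · refine ge_of_tendsto (hc.tendsto.mono_left (nhdsWithin_le_nhds (s := Set.Ioi 0))) ?_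
      filter_upwards [self_mem_nhdsWithin] with t ht
      have ht : 0 < t := ht
      exact nonneg_of_mul_nonneg_right (P t (by linarith)) ht
  simpa [hG] using h0

/-- Dual functional. -/
noncomputable def Dual (c : I → J → ℝ) (q : J → ℝ) (ε ρ : ℝ) (u : I → ℝ) (v : J → ℝ)
    (p : I → ℝ) : ℝ :=
  (∑ i, ρ * (1 - Real.exp (-(u i) / ρ)) * p i) + (∑ j, ρ * (1 - Real.exp (-(v j) / ρ)) * q j)
    - ∑ i, ∑ j, ε * Real.exp ((u i + v j - c i j) / ε)

lemma Fobj_regroup (c : I → J → ℝ) (q : J → ℝ) (ε ρ : ℝ) (u : I → ℝ) (v : J → ℝ)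
    (p : I → ℝ) (γ : I → J → ℝ) : Fobj c p q ε ρ γ =
      (∑ i, (u i * (∑ j, γ i j) + ρ * ((∑ j, γ i j) * Real.log ((∑ j, γ i j) / p i)
        - (∑ j, γ i j) + p i)))
      + (∑ j, (v j * (∑ i, γ i j) + ρ * ((∑ i, γ i j) * Real.log ((∑ i, γ i j) / q j)
        - (∑ i, γ i j) + q j)))
      + ∑ i, ∑ j, (ε * (γ i j * Real.log (γ i j) - γ i j) - (u i + v j - c i j) * γ i j) := by
  have e2 : ∑ j, v j * ∑ i, γ i j = ∑ i, ∑ j, v j * γ i j := by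
    rw [sum_comm]; simp only [mul_sum]
  have e3 : ∑ i, ∑ j, (ε * (γ i j * Real.log (γ i j) - γ i j) - (u i + v j - c i j) * γ i j)
      = ε * (∑ i, ∑ j, γ i j * (Real.log (γ i j) - 1)) + (∑ i, ∑ j, c i j * γ i j)
        - (∑ i, u i * ∑ j, γ i j) - ∑ i, ∑ j, v j * γ i j := by
    simp only [mul_sum, ← sum_add_distrib, ← sum_sub_distrib]
    refine sum_congr rfl fun i _ => sum_congr rfl fun j _ => ?_
    ring
  rw [e3, sum_add_distrib, sum_add_distrib, e2, ← mul_sum, ← mul_sum]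
  unfold Fobj entH klD
  ring

lemma weak_dual (c : I → J → ℝ) (q : J → ℝ) (hq : ∀ j, 0 < q j)
    (ε ρ : ℝ) (hε : 0 < ε) (hρ : 0 < ρ) (u : I → ℝ) (v : J → ℝ) (p : I → ℝ) (hp : ∀ i, 0 < p i)
    (γ : I → J → ℝ) (hnn : ∀ i j, 0 ≤ γ i j) :
    Dual c q ε ρ u v p ≤ Fobj c p q ε ρ γ := by
  rw [Fobj_regroup c q ε ρ u v, Dual, sub_eq_add_neg, ← sum_neg_distrib]
  have T : ∀ u a p : ℝ, 0 ≤ a → 0 < p →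
      ρ * (1 - Real.exp (-u / ρ)) * p ≤ u * a + ρ * (a * Real.log (a / p) - a + p) := by
    intro u a p ha hp
    have := mul_le_mul_of_nonneg_left (kl_ineq a p (-u / ρ) ha hp) hρ.le
    have e : ρ * (-u / ρ * a - p * Real.exp (-u / ρ) + p)
      = -u * a + ρ * (1 - Real.exp (-u / ρ)) * p := by field_simp; ring
    linarith
  refine add_le_add (add_le_add ?_ ?_) ?_
  · exact sum_le_sum fun i _ => T _ _ _ (sum_nonneg fun j _ => hnn i j) (hp i)
  · exact sum_le_sum fun j _ => T _ _ _ (sum_nonneg fun i _ => hnn i j) (hq j)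
  · refine sum_le_sum fun i _ => ?_
    rw [← sum_neg_distrib]
    refine sum_le_sum fun j _ => ?_
    have := mul_le_mul_of_nonneg_left (key_ineq (γ i j) ((u i + v j - c i j) / ε) (hnn i j)) hε.le
    have e : ε * ((u i + v j - c i j) / ε * γ i j - Real.exp ((u i + v j - c i j) / ε))
      = (u i + v j - c i j) * γ i j - ε * Real.exp ((u i + v j - c i j) / ε) := by
      field_simp
    linarith

lemma strong_dual (c : I → J → ℝ) (q : J → ℝ) (hq : ∀ j, 0 < q j)
    (ε ρ : ℝ) (hε : 0 < ε) (hρ : 0 < ρ) (u : I → ℝ) (v : J → ℝ) (p : I → ℝ) (hp : ∀ i, 0 < p i)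
    (γ : I → J → ℝ) (ha : ∀ i, 0 < ∑ j, γ i j) (hb : ∀ j, 0 < ∑ i, γ i j)
    (hu : ∀ i, u i = -ρ * Real.log ((∑ j, γ i j) / p i))
    (hv : ∀ j, v j = -ρ * Real.log ((∑ i, γ i j) / q j))
    (hg : ∀ i j, 0 < γ i j)
    (hs : ∀ i j, u i + v j - c i j = ε * Real.log (γ i j)) :
    Fobj c p q ε ρ γ = Dual c q ε ρ u v p := by
  rw [Fobj_regroup c q ε ρ u v, Dual, sub_eq_add_neg, ← sum_neg_distrib]
  have T : ∀ u a p : ℝ, 0 < a → 0 < p → u = -ρ * Real.log (a / p) →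
      u * a + ρ * (a * Real.log (a / p) - a + p) = ρ * (1 - Real.exp (-u / ρ)) * p := by
    intro u a p ha hp hu
    have : -u / ρ = Real.log (a / p) := by rw [hu]; field_simp
    rw [this, Real.exp_log (by positivity), hu]
    field_simp; ring
  congr 1
  · congr 1
    · exact sum_congr rfl fun i _ => T _ _ _ (ha i) (hp i) (hu i)
    · exact sum_congr rfl fun j _ => T _ _ _ (hb j) (hq j) (hv j)
  · refine sum_congr rfl fun i _ => ?_
    rw [← sum_neg_distrib]
    refine sum_congr rfl fun j _ => ?_
    rw [hs, mul_div_cancel_left₀ _ hε.ne', Real.exp_log (hg i j)]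
    ring

/-- Squeeze between two functions with the same derivative. -/
lemma squeeze_fderiv {E : Type*} [NormedAddCommGroup E] [NormedSpace ℝ E] {L W U : E → ℝ}
    {D : E →L[ℝ] ℝ} {x : E} (hL : HasFDerivAt L D x) (hU : HasFDerivAt U D x)
    (h1 : ∀ᶠ y in nhds x, L y ≤ W y) (h2 : ∀ᶠ y in nhds x, W y ≤ U y)
    (e1 : L x = W x) (e2 : W x = U x) : HasFDerivAt W D x := by
  rw [hasFDerivAt_iff_isLittleO] at *
  rw [Asymptotics.isLittleO_iff] at *
  intro k hk
  filter_upwards [hL hk, hU hk, h1, h2] with y a b c d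
  rw [Real.norm_eq_abs, abs_le] at *
  constructor <;> linarith [a.1, b.2]

lemma U_deriv (c : I → J → ℝ) (q : J → ℝ) (ε ρ : ℝ) (p : I → ℝ) (hp : ∀ i, 0 < p i)
    (γ : I → J → ℝ) (ha : ∀ i, 0 < ∑ j, γ i j) :
    HasFDerivAt (fun p' => Fobj c p' q ε ρ γ)
      (∑ i, (ρ * (1 - (∑ j, γ i j) / p i)) • ContinuousLinearMap.proj (R := ℝ) (φ := fun _ : I => ℝ) i) p := by
  have K : ∀ a x : ℝ, 0 < a → 0 < x →
      HasDerivAt (fun x => a * Real.log (a / x) - a + x) (1 - a / x) x := by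
    intro a x ha hx
    have h1 : HasDerivAt (fun x => a * (Real.log a - Real.log x) - a + x)
        (a * (0 - x⁻¹) - 0 + 1) x :=
      ((((hasDerivAt_const x _).sub (Real.hasDerivAt_log hx.ne')).const_mul a).sub
        (hasDerivAt_const x a)).add (hasDerivAt_id x)
    have h2 := h1.congr_of_eventuallyEq (f₁ := fun x => a * Real.log (a / x) - a + x) (by
      filter_upwards [Ioi_mem_nhds hx] with y hy
      have hy : 0 < y := hy
      rw [Real.log_div ha.ne' hy.ne'])
    have e : a * (0 - x⁻¹) - 0 + 1 = 1 - a / x := by rw [div_eq_mul_inv]; ring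
    rwa [e] at h2
  have S : HasFDerivAt (fun p' : I → ℝ => klD (fun i => ∑ j, γ i j) p')
      (∑ i, (1 - (∑ j, γ i j) / p i) • ContinuousLinearMap.proj (R := ℝ) (φ := fun _ : I => ℝ) i) p := by
    unfold klD
    refine HasFDerivAt.fun_sum fun i _ => ?_
    have hi : HasFDerivAt (fun f : I → ℝ => f i)
        (ContinuousLinearMap.proj (R := ℝ) (φ := fun _ : I => ℝ) i) p := hasFDerivAt_apply i p
    exact HasDerivAt.comp_hasFDerivAt (f := fun f : I → ℝ => f i) p (K _ _ (ha i) (hp i)) hi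
  have := ((S.const_mul ρ).const_add ((∑ i, ∑ j, c i j * γ i j) - ε * entH γ)).add_const
    (ρ * klD (fun j => ∑ i, γ i j) q)
  refine this.congr_fderiv ?_
  rw [smul_sum]
  simp only [smul_smul]

end



/-- `p ↦ W(p)` is differentiable on the open positive orthant, with gradient
`∂W/∂p i = ρ (1 - exp(-u i/ρ)) = ρ (1 - (∑_j γ* i j)/p i)`. -/
theorem stmt_13 {I J : Type*} [Fintype I] [Fintype J] [Nonempty I] [Nonempty J]
    (c : I → J → ℝ) (q : J → ℝ) (hq : ∀ j, 0 < q j)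
    (ε ρ : ℝ) (hε : 0 < ε) (hρ : 0 < ρ)
    (p : I → ℝ) (hp : ∀ i, 0 < p i)
    (γstar : I → J → ℝ) (hnn : ∀ i j, 0 ≤ γstar i j)
    (hmin : ∀ γ : I → J → ℝ, (∀ i j, 0 ≤ γ i j) →
      Fobj c p q ε ρ γstar ≤ Fobj c p q ε ρ γ)
    (u : I → ℝ) (hu : ∀ i, u i = -ρ * Real.log ((∑ j, γstar i j) / p i)) :
    DifferentiableAt ℝ (Wfun c q ε ρ) p ∧
    (∀ h : I → ℝ, fderiv ℝ (Wfun c q ε ρ) p h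
        = ∑ i, ρ * (1 - Real.exp (-(u i) / ρ)) * h i) ∧
    (∀ i, ρ * (1 - Real.exp (-(u i) / ρ)) = ρ * (1 - (∑ j, γstar i j) / p i)) := by
  have gp := gpos c q hq ε ρ hε hρ p hp γstar hnn hmin
  have st := stat c q hq ε ρ hε hρ p hp γstar hnn hmin
  have ha : ∀ i, 0 < ∑ j, γstar i j := fun i =>
    sum_pos (fun j _ => gp i j) univ_nonempty
  have hb : ∀ j, 0 < ∑ i, γstar i j := fun j =>
    sum_pos (fun i _ => gp i j) univ_nonempty
  have third : ∀ i, ρ * (1 - Real.exp (-(u i) / ρ)) = ρ * (1 - (∑ j, γstar i j) / p i) := by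
    intro i
    have : -u i / ρ = Real.log ((∑ j, γstar i j) / p i) := by rw [hu]; field_simp
    rw [this, Real.exp_log (div_pos (ha i) (hp i))]
  set v : J → ℝ := fun j => -ρ * Real.log ((∑ i, γstar i j) / q j) with hv
  have sd := strong_dual c q hq ε ρ hε hρ u v p hp γstar ha hb hu (fun j => rfl) gp (by
    intro i j
    have := st i j
    simp only [hv, hu]
    linarith)
  have wd := weak_dual c q hq ε ρ hε hρ u v
  have lower : ∀ p' : I → ℝ, (∀ i, 0 < p' i) → Dual c q ε ρ u v p' ≤ Wfun c q ε ρ p' := by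
    intro p' hp'
    refine le_csInf ⟨_, γstar, hnn, rfl⟩ ?_
    rintro w ⟨γ, hγ, rfl⟩
    exact wd p' hp' γ hγ
  have upper : ∀ p' : I → ℝ, (∀ i, 0 < p' i) → Wfun c q ε ρ p' ≤ Fobj c p' q ε ρ γstar := by
    intro p' hp'
    refine csInf_le ⟨Dual c q ε ρ u v p', ?_⟩ ⟨γstar, hnn, rfl⟩
    rintro w ⟨γ, hγ, rfl⟩
    exact wd p' hp' γ hγ
  have ev : ∀ᶠ p' : I → ℝ in nhds p, ∀ i, 0 < p' i := by
    rw [Filter.eventually_all]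
    intro i
    exact (continuous_apply i).continuousAt.eventually (Ioi_mem_nhds (hp i))
  have hU := U_deriv c q ε ρ p hp γstar ha
  have hL : HasFDerivAt (Dual c q ε ρ u v)
      (∑ i, (ρ * (1 - (∑ j, γstar i j) / p i)) •
        ContinuousLinearMap.proj (R := ℝ) (φ := fun _ : I => ℝ) i) p := by
    unfold Dual
    refine HasFDerivAt.sub_const _ (HasFDerivAt.add_const _ ?_)
    refine HasFDerivAt.fun_sum fun i _ => ?_
    rw [← third i]
    exact (hasFDerivAt_apply i p).const_mul _
  have l := lower p hp
  have r := upper p hp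
  have main := squeeze_fderiv hL hU (ev.mono fun p' h => lower p' h)
    (ev.mono fun p' h => upper p' h) (by linarith) (by linarith)
  refine ⟨main.differentiableAt, fun h => ?_, third⟩
  rw [main.fderiv]
  simp [third]
end

section
/- Let d ≥ 1, let c : ℝ^d × ℝ^d → ℝ be continuously differentiable, fix y : J → ℝ^d, p, q, ε > 0, ρ > 0, and define W̃(x) = min { F(γ; x) : γ i j ≥ 0 } where F(γ; x) is the unbalanced entropic objective with cost matrix c(x i, y j). Then W̃ is differentiable in x = (x i)_{i∈I} ∈ (ℝ^d)^I, and its partial gradient with respect to x i equals Σ_j γ* i j · ∇₁c(x i, y j), where γ* is the unique minimizer of F(·; x) and ∇₁c denotes the gradient of c in its first variable. -/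
open Finset Real

/-- Tangent inequality for `s log (s/p) - s`. -/
lemma aux_tangent {a s p : ℝ} (ha : 0 ≤ a) (hs : 0 < s) (hp : 0 < p) :
    a * Real.log (s / p) - s ≤ a * Real.log (a / p) - a := by
  rcases ha.eq_or_lt with rfl | ha
  · simp; exact hs.le
  · have h := Real.log_le_sub_one_of_pos (div_pos hs ha)
    rw [Real.log_div hs.ne' ha.ne'] at h
    rw [Real.log_div hs.ne' hp.ne', Real.log_div ha.ne' hp.ne']
    have h2 := mul_le_mul_of_nonneg_left h ha.le
    have h3 : a * (s / a - 1) = s - a := by field_simp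
    rw [h3] at h2
    linarith

lemma aux_fenchel_s14 {g gs ε δ : ℝ} (hg : 0 ≤ g) (hgs : 0 < gs) (hε : 0 < ε) :
    ε * (gs * (1 - Real.exp (-δ / ε))) ≤
      δ * g + ε * (g * Real.log (g / gs) - g + gs) := by
  have h := aux_tangent hg (mul_pos hgs (Real.exp_pos (-δ / ε))) hgs
  rw [mul_div_cancel_left₀ _ hgs.ne', Real.log_exp] at h
  have h2 := mul_le_mul_of_nonneg_left h hε.le
  have h3 : ε * (g * (-δ / ε) - gs * Real.exp (-δ / ε))
      = - (δ * g) - ε * (gs * Real.exp (-δ / ε)) := by field_simp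
  rw [h3] at h2
  linarith

/-- Gradient of the objective. -/
noncomputable def auxD {I J : Type*} [Fintype I] [Fintype J]
    (C : I → J → ℝ) (p : I → ℝ) (q : J → ℝ) (ε ρ : ℝ) (σ : I → J → ℝ) (i : I) (j : J) : ℝ :=
  C i j + ε * Real.log (σ i j) + ρ * Real.log ((∑ j', σ i j') / p i)
    + ρ * Real.log ((∑ i', σ i' j) / q j)

lemma aux_kl_s14 {I : Type*} [Fintype I] {h s p : I → ℝ} (hh : ∀ i, 0 ≤ h i) (hs : ∀ i, 0 < s i)
    (hp : ∀ i, 0 < p i) :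
    klD s p + ∑ i, Real.log (s i / p i) * (h i - s i) ≤ klD h p := by
  unfold klD
  rw [← Finset.sum_add_distrib]
  refine Finset.sum_le_sum fun i _ => ?_
  have := aux_tangent (hh i) (hs i) (hp i)
  linarith

lemma aux_F {I J : Type*} [Fintype I] [Fintype J] [Nonempty I] [Nonempty J]
    (C : I → J → ℝ) (p : I → ℝ) (q : J → ℝ) (hp : ∀ i, 0 < p i) (hq : ∀ j, 0 < q j)
    (ε ρ : ℝ) (hρ : 0 < ρ) (γ σ : I → J → ℝ)
    (hγ : ∀ i j, 0 ≤ γ i j) (hσ : ∀ i j, 0 < σ i j) :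
    Fobj C p q ε ρ σ + ∑ i, ∑ j, auxD C p q ε ρ σ i j * (γ i j - σ i j)
      + ∑ i, ∑ j, ε * (γ i j * Real.log (γ i j / σ i j) - γ i j + σ i j)
      ≤ Fobj C p q ε ρ γ := by
  have h1 := aux_kl_s14 (h := fun i => ∑ j, γ i j) (s := fun i => ∑ j, σ i j) (p := p)
    (fun i => Finset.sum_nonneg fun j _ => hγ i j)
    (fun i => Finset.sum_pos (fun j _ => hσ i j) Finset.univ_nonempty) hp
  have h2 := aux_kl_s14 (h := fun j => ∑ i, γ i j) (s := fun j => ∑ i, σ i j) (p := q)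
    (fun j => Finset.sum_nonneg fun i _ => hγ i j)
    (fun j => Finset.sum_pos (fun i _ => hσ i j) Finset.univ_nonempty) hq
  have h1' := mul_le_mul_of_nonneg_left h1 hρ.le
  have h2' := mul_le_mul_of_nonneg_left h2 hρ.le
  have e1 : ∑ i, Real.log ((∑ j, σ i j) / p i) * ((∑ j, γ i j) - ∑ j, σ i j)
      = ∑ i, ∑ j, Real.log ((∑ j', σ i j') / p i) * (γ i j - σ i j) := by
    refine Finset.sum_congr rfl fun i _ => ?_
    rw [← Finset.sum_sub_distrib, Finset.mul_sum]
  have e2 : ∑ j, Real.log ((∑ i, σ i j) / q j) * ((∑ i, γ i j) - ∑ i, σ i j)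
      = ∑ i, ∑ j, Real.log ((∑ i', σ i' j) / q j) * (γ i j - σ i j) := by
    rw [Finset.sum_comm]
    refine Finset.sum_congr rfl fun i _ => ?_
    rw [← Finset.sum_sub_distrib, Finset.mul_sum]
  have e3 : (∑ i, ∑ j, C i j * σ i j) - ε * entH σ
      + ∑ i, ∑ j, auxD C p q ε ρ σ i j * (γ i j - σ i j)
      + ∑ i, ∑ j, ε * (γ i j * Real.log (γ i j / σ i j) - γ i j + σ i j)
      = (∑ i, ∑ j, C i j * γ i j) - ε * entH γ
        + ρ * (∑ i, ∑ j, Real.log ((∑ j', σ i j') / p i) * (γ i j - σ i j))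
        + ρ * (∑ i, ∑ j, Real.log ((∑ i', σ i' j) / q j) * (γ i j - σ i j)) := by
    unfold entH
    simp only [mul_neg, sub_neg_eq_add, Finset.mul_sum, ← Finset.sum_add_distrib]
    refine Finset.sum_congr rfl fun i _ => Finset.sum_congr rfl fun j _ => ?_
    unfold auxD
    rcases (hγ i j).eq_or_lt with h0 | h0
    · rw [← h0]; simp; ring
    · rw [Real.log_div h0.ne' (hσ i j).ne']; ring
  rw [mul_add] at h1' h2'
  rw [e1] at h1'
  rw [e2] at h2'
  unfold Fobj
  linarith

lemma aux_KL_nonneg {I J : Type*} [Fintype I] [Fintype J] {ε : ℝ} (hε : 0 < ε)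
    (γ σ : I → J → ℝ) (hγ : ∀ i j, 0 ≤ γ i j) (hσ : ∀ i j, 0 < σ i j) :
    0 ≤ ∑ i, ∑ j, ε * (γ i j * Real.log (γ i j / σ i j) - γ i j + σ i j) := by
  refine Finset.sum_nonneg fun i _ => Finset.sum_nonneg fun j _ => ?_
  have := aux_fenchel_s14 (δ := 0) (hγ i j) (hσ i j) hε
  simpa using this

lemma aux_pos {I J : Type*} [Fintype I] [Fintype J] [Nonempty I] [Nonempty J]
    (C : I → J → ℝ) (p : I → ℝ) (q : J → ℝ) (hp : ∀ i, 0 < p i) (hq : ∀ j, 0 < q j)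
    (ε ρ : ℝ) (hε : 0 < ε) (hρ : 0 < ρ) (g : I → J → ℝ)
    (hg : ∀ i j, 0 ≤ g i j)
    (hmin : ∀ γ : I → J → ℝ, (∀ i j, 0 ≤ γ i j) → Fobj C p q ε ρ g ≤ Fobj C p q ε ρ γ) :
    ∀ i j, 0 < g i j := by
  by_contra! hcon
  obtain ⟨i0, j0, h0⟩ := hcon
  have h0 : g i0 j0 = 0 := le_antisymm h0 (hg i0 j0)
  -- bound
  set U : I → J → ℝ := fun i j => C i j + ε * g i j
    + ρ * Real.log ((∑ j', (g i j' + 1)) / p i) + ρ * Real.log ((∑ i', (g i' j + 1)) / q j)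
    with hU
  have key : ∀ t : ℝ, 0 < t → t ≤ 1 → 0 ≤ (∑ i, ∑ j, U i j) + ε * Real.log t := by
    intro t ht ht1
    have hσ : ∀ i j, 0 < g i j + t := fun i j => add_pos_of_nonneg_of_pos (hg i j) ht
    have hF := aux_F C p q hp hq ε ρ hρ g (fun i j => g i j + t) hg hσ
    have hK := aux_KL_nonneg hε g (fun i j => g i j + t) hg hσ
    have hm := hmin (fun i j => g i j + t) (fun i j => (hσ i j).le)
    have hD : ∑ i, ∑ j, auxD C p q ε ρ (fun i j => g i j + t) i j * (g i j - (g i j + t))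
        = - (t * ∑ i, ∑ j, auxD C p q ε ρ (fun i j => g i j + t) i j) := by
      simp only [Finset.mul_sum, ← Finset.sum_neg_distrib]
      refine Finset.sum_congr rfl fun i _ => Finset.sum_congr rfl fun j _ => ?_
      ring
    rw [hD] at hF
    have hD0 : 0 ≤ ∑ i, ∑ j, auxD C p q ε ρ (fun i j => g i j + t) i j := by
      by_contra! hneg
      have := mul_neg_of_pos_of_neg ht hneg
      linarith
    have hb : ∀ i j, auxD C p q ε ρ (fun i j => g i j + t) i j
        ≤ U i j + ε * (Real.log (g i j + t) - g i j) := by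
      intro i j
      have b1 : Real.log ((∑ j', (g i j' + t)) / p i) ≤ Real.log ((∑ j', (g i j' + 1)) / p i) := by
        apply Real.log_le_log
        · exact div_pos (Finset.sum_pos (fun j _ => hσ i j) Finset.univ_nonempty) (hp i)
        · have := (hp i).le
          gcongr
      have b2 : Real.log ((∑ i', (g i' j + t)) / q j) ≤ Real.log ((∑ i', (g i' j + 1)) / q j) := by
        apply Real.log_le_log
        · exact div_pos (Finset.sum_pos (fun i _ => hσ i j) Finset.univ_nonempty) (hq j)
        · have := (hq j).le
          gcongr
      have b1' := mul_le_mul_of_nonneg_left b1 hρ.le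
      have b2' := mul_le_mul_of_nonneg_left b2 hρ.le
      simp only [auxD, hU]
      linarith
    have hs := Finset.sum_le_sum (s := Finset.univ) fun i _ =>
      Finset.sum_le_sum (s := Finset.univ) fun j _ => hb i j
    simp only [Finset.sum_add_distrib (g := fun j => ε * (Real.log (g _ j + t) - g _ j))] at hs
    rw [Finset.sum_add_distrib] at hs
    have hle : ∀ i j, ε * (Real.log (g i j + t) - g i j) ≤ 0 := by
      intro i j
      have := Real.log_le_sub_one_of_pos (hσ i j)
      exact mul_nonpos_of_nonneg_of_nonpos hε.le (by linarith)
    have hsing : ∑ i, ∑ j, ε * (Real.log (g i j + t) - g i j) ≤ ε * Real.log t := by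
      have s1 : ∑ i, ∑ j, ε * (Real.log (g i j + t) - g i j)
          ≤ ∑ j, ε * (Real.log (g i0 j + t) - g i0 j) := by
        have := Finset.single_le_sum (s := Finset.univ)
          (f := fun i => - ∑ j, ε * (Real.log (g i j + t) - g i j))
          (fun i _ => neg_nonneg.2 (Finset.sum_nonpos fun j _ => hle i j)) (Finset.mem_univ i0)
        rw [Finset.sum_neg_distrib] at this
        linarith
      have s2 : ∑ j, ε * (Real.log (g i0 j + t) - g i0 j)
          ≤ ε * (Real.log (g i0 j0 + t) - g i0 j0) := by
        have := Finset.single_le_sum (s := Finset.univ)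
          (f := fun j => - (ε * (Real.log (g i0 j + t) - g i0 j)))
          (fun j _ => neg_nonneg.2 (hle i0 j)) (Finset.mem_univ j0)
        rw [Finset.sum_neg_distrib] at this
        linarith
      rw [h0] at s2
      simp only [zero_add, sub_zero] at s2
      exact s1.trans s2
    linarith
  set S := ∑ i, ∑ j, U i j
  have hk := key (Real.exp (-((|S| + 1) / ε))) (Real.exp_pos _)
    (Real.exp_le_one_iff.2 (neg_nonpos.2 (by positivity)))
  rw [Real.log_exp] at hk
  have : ε * -((|S| + 1) / ε) = -(|S| + 1) := by field_simp
  rw [this] at hk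
  linarith [le_abs_self S]

lemma aux_foc {I J : Type*} [Fintype I] [Fintype J] [Nonempty I] [Nonempty J]
    (C : I → J → ℝ) (p : I → ℝ) (q : J → ℝ) (hp : ∀ i, 0 < p i) (hq : ∀ j, 0 < q j)
    (ε ρ : ℝ) (hε : 0 < ε) (hρ : 0 < ρ) (g : I → J → ℝ)
    (hg : ∀ i j, 0 < g i j)
    (hmin : ∀ γ : I → J → ℝ, (∀ i j, 0 ≤ γ i j) → Fobj C p q ε ρ g ≤ Fobj C p q ε ρ γ)
    (γ : I → J → ℝ) (hγ : ∀ i j, 0 ≤ γ i j) :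
    0 ≤ ∑ i, ∑ j, auxD C p q ε ρ g i j * (γ i j - g i j) := by
  set σ : ℝ → I → J → ℝ := fun t i j => g i j + t * (γ i j - g i j) with hσd
  have hcont : ContinuousAt (fun t => ∑ i, ∑ j, auxD C p q ε ρ (σ t) i j * (γ i j - g i j)) 0 := by
    have hs : ∀ i j, ContinuousAt (fun t => σ t i j) 0 := fun i j => by
      simp only [hσd]; fun_prop
    refine tendsto_finsetSum _ fun i _ => tendsto_finsetSum _ fun j _ => ?_
    refine Filter.Tendsto.mul ?_ tendsto_const_nhds
    unfold auxD
    have r1 : ContinuousAt (fun t => ∑ j', σ t i j') 0 :=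
      tendsto_finsetSum _ fun j' _ => hs i j'
    have r2 : ContinuousAt (fun t => ∑ i', σ t i' j) 0 :=
      tendsto_finsetSum _ fun i' _ => hs i' j
    have p1 : (∑ j', σ 0 i j') / p i ≠ 0 := by
      simp only [hσd, zero_mul, add_zero]
      exact (div_pos (Finset.sum_pos (fun j _ => hg i j) Finset.univ_nonempty) (hp i)).ne'
    have p2 : (∑ i', σ 0 i' j) / q j ≠ 0 := by
      simp only [hσd, zero_mul, add_zero]
      exact (div_pos (Finset.sum_pos (fun i _ => hg i j) Finset.univ_nonempty) (hq j)).ne'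
    have p0 : σ 0 i j ≠ 0 := by
      simp only [hσd, zero_mul, add_zero]
      exact (hg i j).ne'
    have c0 := (hs i j).log p0
    have c1 := (r1.div_const (p i)).log p1
    have c2 := (r2.div_const (q j)).log p2
    exact ((continuousAt_const.add (c0.const_mul ε)).add (c1.const_mul ρ)).add (c2.const_mul ρ)
  have hσ0 : σ 0 = g := by
    funext i j; simp [hσd]
  have ht : Filter.Tendsto
      (fun t => ∑ i, ∑ j, auxD C p q ε ρ (σ t) i j * (γ i j - g i j)) (nhdsWithin 0 (Set.Ioi 0))
      (nhds (∑ i, ∑ j, auxD C p q ε ρ g i j * (γ i j - g i j))) := by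
    have := hcont.tendsto.mono_left (nhdsWithin_le_nhds (s := Set.Ioi 0))
    simpa only [hσ0] using this
  refine ge_of_tendsto ht ?_
  filter_upwards [Ioo_mem_nhdsGT (zero_lt_one (α := ℝ))] with t ht
  have hpos : ∀ i j, 0 < σ t i j := by
    intro i j
    have e : σ t i j = (1 - t) * g i j + t * γ i j := by simp only [hσd]; ring
    rw [e]
    exact add_pos_of_pos_of_nonneg (mul_pos (by linarith [ht.2]) (hg i j))
      (mul_nonneg ht.1.le (hγ i j))
  have hF := aux_F C p q hp hq ε ρ hρ g (σ t) (fun i j => (hg i j).le) hpos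
  have hK := aux_KL_nonneg hε g (σ t) (fun i j => (hg i j).le) hpos
  have hm := hmin (σ t) (fun i j => (hpos i j).le)
  have hD : ∑ i, ∑ j, auxD C p q ε ρ (σ t) i j * (g i j - σ t i j)
      = - (t * ∑ i, ∑ j, auxD C p q ε ρ (σ t) i j * (γ i j - g i j)) := by
    simp only [Finset.mul_sum, ← Finset.sum_neg_distrib]
    refine Finset.sum_congr rfl fun i _ => Finset.sum_congr rfl fun j _ => ?_
    simp only [hσd]
    ring
  rw [hD] at hF
  by_contra! hneg
  have := mul_neg_of_pos_of_neg ht.1 hneg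
  linarith

lemma aux_squeeze {E : Type*} [NormedAddCommGroup E] [NormedSpace ℝ E] {f l u : E → ℝ}
    {L : E →L[ℝ] ℝ} {x : E} (hl : HasFDerivAt l L x) (hu : HasFDerivAt u L x)
    (h1 : ∀ z, l z ≤ f z) (h2 : ∀ z, f z ≤ u z) (hx : l x = u x) : HasFDerivAt f L x := by
  have hd : HasFDerivAt (fun z => u z - l z) (0 : E →L[ℝ] ℝ) x := by
    simpa using hu.fun_sub hl
  have hfu : HasFDerivAt (fun z => u z - f z) (0 : E →L[ℝ] ℝ) x := by
    have e : u x - f x = 0 := by linarith [h1 x, h2 x]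
    refine .of_isLittleO ?_
    have := hd.isLittleO
    simp only [e, hx, sub_self, sub_zero, zero_apply] at this ⊢
    refine (Asymptotics.isBigO_of_le _ fun z => ?_).trans_isLittleO this
    rw [Real.norm_eq_abs, Real.norm_eq_abs, abs_of_nonneg (by linarith [h2 z]),
      abs_of_nonneg (by linarith [h1 z, h2 z])]
    linarith [h1 z]
  simpa using hu.fun_sub hfu

open RealInnerProductSpace in
/-- Differentiability of the unbalanced entropic transport cost with respect to the
source points, with gradient `∑_j γ* i j · ∇₁c(x i, y j)` in the `i`-th slot. -/
theorem stmt_14 {I J : Type*} [Fintype I] [Fintype J] [Nonempty I] [Nonempty J]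
    (d : ℕ) (hd : 1 ≤ d)
    (c : EuclideanSpace ℝ (Fin d) → EuclideanSpace ℝ (Fin d) → ℝ)
    (hc : ContDiff ℝ 1 (fun z : EuclideanSpace ℝ (Fin d) × EuclideanSpace ℝ (Fin d) =>
      c z.1 z.2))
    (y : J → EuclideanSpace ℝ (Fin d))
    (p : I → ℝ) (q : J → ℝ) (hp : ∀ i, 0 < p i) (hq : ∀ j, 0 < q j)
    (ε ρ : ℝ) (hε : 0 < ε) (hρ : 0 < ρ)
    (W : (I → EuclideanSpace ℝ (Fin d)) → ℝ)
    (hW : ∀ x : I → EuclideanSpace ℝ (Fin d),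
      W x = sInf {w : ℝ | ∃ γ : I → J → ℝ, (∀ i j, 0 ≤ γ i j) ∧
        Fobj (fun i j => c (x i) (y j)) p q ε ρ γ = w})
    (x : I → EuclideanSpace ℝ (Fin d))
    (γstar : I → J → ℝ) (hnn : ∀ i j, 0 ≤ γstar i j)
    (hmin : ∀ γ : I → J → ℝ, (∀ i j, 0 ≤ γ i j) →
      Fobj (fun i j => c (x i) (y j)) p q ε ρ γstar
        ≤ Fobj (fun i j => c (x i) (y j)) p q ε ρ γ) :
    DifferentiableAt ℝ W x ∧
    ∀ h : I → EuclideanSpace ℝ (Fin d),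
      fderiv ℝ W x h
        = ∑ i, ⟪∑ j, γstar i j • gradient (fun a => c a (y j)) (x i), h i⟫ := by
  set C : (I → EuclideanSpace ℝ (Fin d)) → I → J → ℝ := fun z i j => c (z i) (y j) with hC
  have hpos := aux_pos (C x) p q hp hq ε ρ hε hρ γstar hnn hmin
  have hlow : ∀ z, ∀ γ : I → J → ℝ, (∀ i j, 0 ≤ γ i j) →
      Fobj (C x) p q ε ρ γstar
        + ∑ i, ∑ j, ε * (γstar i j * (1 - Real.exp (-(C z i j - C x i j) / ε)))
      ≤ Fobj (C z) p q ε ρ γ := by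
    intro z γ hγ
    have h1 := aux_F (C x) p q hp hq ε ρ hρ γ γstar hγ hpos
    have h2 := aux_foc (C x) p q hp hq ε ρ hε hρ γstar hpos hmin γ hγ
    have h3 : ∑ i, ∑ j, ε * (γstar i j * (1 - Real.exp (-(C z i j - C x i j) / ε)))
        ≤ ∑ i, ∑ j, ((C z i j - C x i j) * γ i j
          + ε * (γ i j * Real.log (γ i j / γstar i j) - γ i j + γstar i j)) :=
      Finset.sum_le_sum fun i _ => Finset.sum_le_sum fun j _ =>
        aux_fenchel_s14 (hγ i j) (hpos i j) hε
    simp only [Finset.sum_add_distrib, sub_mul, Finset.sum_sub_distrib] at h3 h1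
    simp only [Fobj] at h1 ⊢
    linarith
  have hup : ∀ z, Fobj (C z) p q ε ρ γstar
      = Fobj (C x) p q ε ρ γstar + ∑ i, ∑ j, γstar i j * (C z i j - C x i j) := by
    intro z
    have : ∑ i, ∑ j, γstar i j * (C z i j - C x i j)
        = (∑ i, ∑ j, C z i j * γstar i j) - ∑ i, ∑ j, C x i j * γstar i j := by
      simp only [← Finset.sum_sub_distrib]
      refine Finset.sum_congr rfl fun i _ => Finset.sum_congr rfl fun j _ => ?_
      ring
    rw [this]
    simp only [Fobj]
    ring
  have hWl : ∀ z, Fobj (C x) p q ε ρ γstar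
        + ∑ i, ∑ j, ε * (γstar i j * (1 - Real.exp (-(C z i j - C x i j) / ε))) ≤ W z := by
    intro z
    rw [hW]
    refine le_csInf ⟨_, γstar, hnn, rfl⟩ ?_
    rintro w ⟨γ, hγ, rfl⟩
    exact hlow z γ hγ
  have hWu : ∀ z, W z ≤
      Fobj (C x) p q ε ρ γstar + ∑ i, ∑ j, γstar i j * (C z i j - C x i j) := by
    intro z
    rw [hW, ← hup]
    refine csInf_le ⟨Fobj (C x) p q ε ρ γstar
        + ∑ i, ∑ j, ε * (γstar i j * (1 - Real.exp (-(C z i j - C x i j) / ε))), ?_⟩ ⟨γstar, hnn, rfl⟩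
    rintro w ⟨γ, hγ, rfl⟩
    exact hlow z γ hγ
  set G : I → J → EuclideanSpace ℝ (Fin d) := fun i j => gradient (fun a => c a (y j)) (x i) with hG
  set K : I → J → ((I → EuclideanSpace ℝ (Fin d)) →L[ℝ] ℝ) := fun i j =>
    (innerSL ℝ (G i j)).comp
      (ContinuousLinearMap.proj (R := ℝ) (φ := fun _ : I => EuclideanSpace ℝ (Fin d)) i) with hK
  have hder : ∀ i j, HasFDerivAt (fun z => C z i j) (K i j) x := by
    intro i j
    have hd1 : DifferentiableAt ℝ (fun a => c a (y j)) (x i) := by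
      have h := (hc.differentiable one_ne_zero) (x i, y j)
      exact h.comp (x i) (f := fun a => (a, y j)) (by fun_prop)
    have hd2 := hd1.hasGradientAt.hasFDerivAt
    exact hd2.comp x (hasFDerivAt_apply (𝕜 := ℝ) i x)
  have hd0 : ∀ i j, HasFDerivAt (fun z => C z i j - C x i j) (K i j) x := fun i j =>
    (hder i j).sub_const _
  have hmain : HasFDerivAt W (∑ i, ∑ j, γstar i j • K i j) x := by
    refine aux_squeeze ?_ ?_ hWl hWu ?_
    · refine HasFDerivAt.const_add _ (HasFDerivAt.fun_sum fun i _ => HasFDerivAt.fun_sum fun j _ => ?_)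
      have h := ((((hd0 i j).fun_neg.mul_const ε⁻¹).exp.const_sub 1).const_mul
        (γstar i j)).const_mul ε
      simp only [← div_eq_mul_inv] at h
      refine h.congr_fderiv ?_
      ext v
      simp
      field_simp
    · exact HasFDerivAt.const_add _ (HasFDerivAt.fun_sum fun i _ => HasFDerivAt.fun_sum fun j _ =>
        (hd0 i j).const_mul _)
    · simp
  refine ⟨hmain.differentiableAt, fun h => ?_⟩
  rw [hmain.fderiv]
  simp [hK, hG, sum_inner, inner_smul_left]
end

section
/- Balanced gradient formula: with Σ_i p i = Σ_j q j and ε > 0, define W_ε(p) = min { Σ_{i,j} c i j·γ i j − ε·H(γ) : γ ∈ Π(p,q) }. Let (u, v) be a balanced Sinkhorn fixed point, so that γ i j = exp((u i + v j − c i j)/ε) has marginals p and q. Then for every direction h : I → ℝ with Σ_i h i = 0, the directional derivative of W_ε at p along h exists and equals Σ_i u i·h i; i.e. u is a gradient of W_ε on the affine set of fixed total mass, up to an additive constant. -/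
open Finset Real

/-- Membership in the transport polytope `Π(p,q)`. -/
def inPolytope {I J : Type*} [Fintype I] [Fintype J]
    (p : I → ℝ) (q : J → ℝ) (γ : I → J → ℝ) : Prop :=
  (∀ i j, 0 ≤ γ i j) ∧ (∀ i, ∑ j, γ i j = p i) ∧ (∀ j, ∑ i, γ i j = q j)

/-- The balanced entropic transport cost as a function of the source weights. -/
noncomputable def Wbal {I J : Type*} [Fintype I] [Fintype J]
    (c : I → J → ℝ) (q : J → ℝ) (ε : ℝ) (p : I → ℝ) : ℝ :=
  sInf {w : ℝ | ∃ γ : I → J → ℝ, inPolytope p q γ ∧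
    (∑ i, ∑ j, c i j * γ i j) - ε * entH γ = w}

/-- Squeeze principle for derivatives. -/
lemma hasDerivAt_squeeze_aux {L W F : ℝ → ℝ} {d : ℝ} (hL : HasDerivAt L d 0)
    (hF : HasDerivAt F d 0) (h0 : L 0 = F 0) (h1 : ∀ᶠ t in nhds (0 : ℝ), L t ≤ W t)
    (h2 : ∀ᶠ t in nhds (0 : ℝ), W t ≤ F t) : HasDerivAt W d 0 := by
  have hW0 : W 0 = L 0 := le_antisymm (h0 ▸ h2.self_of_nhds) h1.self_of_nhds
  rw [hasDerivAt_iff_isLittleO] at *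
  refine Asymptotics.IsBigO.trans_isLittleO ?_ (hL.norm_left.add hF.norm_left)
  refine Asymptotics.IsBigO.of_bound 1 ?_
  filter_upwards [h1, h2] with t a b
  simp only [Real.norm_eq_abs, one_mul]
  rw [hW0, ← h0]
  have e1 := neg_abs_le (L t - L 0 - (t - 0) • d)
  have e2 := le_abs_self (F t - L 0 - (t - 0) • d)
  have e3 := abs_nonneg (L t - L 0 - (t - 0) • d)
  have e4 := abs_nonneg (F t - L 0 - (t - 0) • d)
  refine le_trans ?_ (le_abs_self _)
  rw [abs_le]
  constructor <;> linarith

/-- Fenchel-Young inequality for the entropy. -/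
lemma young_ent_aux (x a : ℝ) (hx : 0 ≤ x) : x * a - Real.exp a ≤ x * (Real.log x - 1) := by
  rcases hx.eq_or_lt with rfl | hx
  · simp [Real.exp_nonneg]
  · have h := Real.add_one_le_exp (a - Real.log x)
    rw [Real.exp_sub, Real.exp_log hx, le_div_iff₀ hx] at h
    linarith

lemma obj_eq_aux {I J : Type*} [Fintype I] [Fintype J] (c γ : I → J → ℝ) (ε : ℝ) :
    (∑ i, ∑ j, c i j * γ i j) - ε * entH γ
      = ∑ i, ∑ j, (c i j * γ i j + ε * (γ i j * (Real.log (γ i j) - 1))) := by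
  simp only [entH, Finset.sum_add_distrib, ← Finset.mul_sum]
  ring

lemma lower_aux {I J : Type*} [Fintype I] [Fintype J]
    (c : I → J → ℝ) (p p' : I → ℝ) (q : J → ℝ) (ε : ℝ) (hε : 0 < ε)
    (u : I → ℝ) (v : J → ℝ)
    (hmargp : ∀ i, ∑ j, Real.exp ((u i + v j - c i j) / ε) = p i)
    (γ : I → J → ℝ) (hγ : inPolytope p' q γ) :
    ∑ i, u i * p' i + ∑ j, v j * q j - ε * ∑ i, p i
      ≤ (∑ i, ∑ j, c i j * γ i j) - ε * entH γ := by
  obtain ⟨hn, hr, hc⟩ := hγ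
  have e : ∑ i, u i * p' i + ∑ j, v j * q j - ε * ∑ i, p i
      = ∑ i, ∑ j, ((u i * γ i j + v j * γ i j) - ε * Real.exp ((u i + v j - c i j) / ε)) := by
    simp only [Finset.sum_sub_distrib, Finset.sum_add_distrib, ← Finset.mul_sum, hr, hmargp]
    rw [Finset.sum_comm (f := fun i j => v j * γ i j)]
    simp only [← Finset.mul_sum, hc]
  rw [e, obj_eq_aux]
  refine Finset.sum_le_sum fun i _ => Finset.sum_le_sum fun j _ => ?_
  have h := mul_le_mul_of_nonneg_left
    (young_ent_aux (γ i j) ((u i + v j - c i j) / ε) (hn i j)) hε.le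
  have h2 : ε * (γ i j * ((u i + v j - c i j) / ε)) = γ i j * (u i + v j - c i j) := by
    field_simp
  rw [mul_sub, h2] at h
  linarith

lemma deriv_ent_aux (C ε g k : ℝ) (hg : 0 < g) :
    HasDerivAt (fun t : ℝ => C * (g + t * k) + ε * ((g + t * k) * (Real.log (g + t * k) - 1)))
      ((C + ε * Real.log g) * k) 0 := by
  have h1 : HasDerivAt (fun t : ℝ => g + t * k) k 0 := by
    simpa using ((hasDerivAt_id (0 : ℝ)).mul_const k).const_add g
  have hne : g + 0 * k ≠ 0 := by simpa using hg.ne'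
  have h2 := (h1.const_mul C).add ((h1.mul ((h1.log hne).sub_const 1)).const_mul ε)
  refine h2.congr_deriv ?_
  simp only [zero_mul, add_zero]
  field_simp
  ring

/-- Balanced gradient formula: at a balanced Sinkhorn fixed point `(u,v)`, for any
mass-preserving direction `h` the directional derivative of `W_ε` at `p` along `h`
exists and equals `∑_i u i · h i`. -/
theorem stmt_16 {I J : Type*} [Fintype I] [Fintype J] [Nonempty I] [Nonempty J]
    (c : I → J → ℝ) (p : I → ℝ) (q : J → ℝ) (hp : ∀ i, 0 < p i) (hq : ∀ j, 0 < q j)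
    (hbal : ∑ i, p i = ∑ j, q j)
    (ε : ℝ) (hε : 0 < ε)
    (u : I → ℝ) (v : J → ℝ)
    (hmargp : ∀ i, ∑ j, Real.exp ((u i + v j - c i j) / ε) = p i)
    (hmargq : ∀ j, ∑ i, Real.exp ((u i + v j - c i j) / ε) = q j) :
    ∀ h : I → ℝ, ∑ i, h i = 0 →
      HasDerivAt (fun t : ℝ => Wbal c q ε (fun i => p i + t * h i))
        (∑ i, u i * h i) 0 := by
  intro h hh
  set g : I → J → ℝ := fun i j => Real.exp ((u i + v j - c i j) / ε) with hgdef
  have hg : ∀ i j, 0 < g i j := fun i j => Real.exp_pos _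
  have hlog : ∀ i j, c i j + ε * Real.log (g i j) = u i + v j := by
    intro i j
    simp only [hgdef, Real.log_exp]
    field_simp
    ring
  set Q : ℝ := ∑ j, q j with hQ
  have hQpos : 0 < Q := Finset.sum_pos (fun j _ => hq j) Finset.univ_nonempty
  have hQ1 : ∑ j, q j / Q = 1 := by
    rw [← Finset.sum_div]
    exact div_self hQpos.ne'
  let γ : ℝ → I → J → ℝ := fun t i j => g i j + t * (h i * (q j / Q))
  have hpoly : ∀ᶠ t in nhds (0 : ℝ), inPolytope (fun i => p i + t * h i) q (γ t) := by
    have hpos : ∀ᶠ t in nhds (0 : ℝ), ∀ i j, 0 < γ t i j := by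
      rw [Filter.eventually_all]
      intro i
      rw [Filter.eventually_all]
      intro j
      have hc : Continuous fun t : ℝ => γ t i j := by
        simp only [γ]
        fun_prop
      refine hc.continuousAt.eventually (lt_mem_nhds ?_)
      simpa [γ] using hg i j
    filter_upwards [hpos] with t ht
    refine ⟨fun i j => (ht i j).le, fun i => ?_, fun j => ?_⟩
    · simp only [γ, Finset.sum_add_distrib, ← Finset.mul_sum, hQ1, mul_one]
      rw [hmargp i]
    · simp only [γ, Finset.sum_add_distrib, ← Finset.mul_sum, ← Finset.sum_mul, hh, zero_mul,
        mul_zero, add_zero]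
      exact hmargq j
  have hlow : ∀ t : ℝ, ∀ γ' : I → J → ℝ, inPolytope (fun i => p i + t * h i) q γ' →
      ∑ i, u i * (p i + t * h i) + ∑ j, v j * q j - ε * ∑ i, p i
        ≤ (∑ i, ∑ j, c i j * γ' i j) - ε * entH γ' :=
    fun t γ' h' => lower_aux c p _ q ε hε u v hmargp γ' h'
  refine hasDerivAt_squeeze_aux
    (L := fun t => ∑ i, u i * (p i + t * h i) + ∑ j, v j * q j - ε * ∑ i, p i)
    (F := fun t => (∑ i, ∑ j, c i j * γ t i j) - ε * entH (γ t)) ?_ ?_ ?_ ?_ ?_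
  · have h1 : ∀ i ∈ (Finset.univ : Finset I),
        HasDerivAt (fun t : ℝ => u i * (p i + t * h i)) (u i * h i) 0 := by
      intro i _
      simpa using (((hasDerivAt_id (0 : ℝ)).mul_const (h i)).const_add (p i)).const_mul (u i)
    exact ((HasDerivAt.fun_sum h1).add_const _).sub_const _
  · simp only [obj_eq_aux]
    have h1 := HasDerivAt.fun_sum (u := (Finset.univ : Finset I)) fun i _ =>
      HasDerivAt.fun_sum (u := (Finset.univ : Finset J)) fun j _ =>
        deriv_ent_aux (c i j) ε (g i j) (h i * (q j / Q)) (hg i j)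
    refine h1.congr_deriv ?_
    simp only [hlog]
    have e : ∀ i j, (u i + v j) * (h i * (q j / Q))
        = u i * h i * (q j / Q) + h i * (v j * (q j / Q)) := fun i j => by ring
    simp only [e, Finset.sum_add_distrib, ← Finset.mul_sum, ← Finset.sum_mul, hh, hQ1]
    ring
  · have e : ∑ i, u i * p i + ∑ j, v j * q j - ε * ∑ i, p i
        = ∑ i, ∑ j, ((u i * g i j + v j * g i j) - ε * g i j) := by
      simp only [Finset.sum_sub_distrib, Finset.sum_add_distrib, ← Finset.mul_sum, hgdef, hmargp]
      rw [Finset.sum_comm (f := fun i j => v j * Real.exp ((u i + v j - c i j) / ε))]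
      simp only [← Finset.mul_sum, hmargq]
    simp only [obj_eq_aux, γ, zero_mul, add_zero]
    rw [e]
    refine Finset.sum_congr rfl fun i _ => Finset.sum_congr rfl fun j _ => ?_
    have := hlog i j
    linear_combination (-(g i j)) * this
  · filter_upwards [hpoly] with t ht
    refine le_csInf ⟨_, γ t, ht, rfl⟩ ?_
    rintro w ⟨γ', h', rfl⟩
    exact hlow t γ' h'
  · filter_upwards [hpoly] with t ht
    refine csInf_le ⟨∑ i, u i * (p i + t * h i) + ∑ j, v j * q j - ε * ∑ i, p i, ?_⟩
      ⟨γ t, ht, rfl⟩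
    rintro w ⟨γ', h', rfl⟩
    exact hlow t γ' h'
end
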